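/- Let 0 < p, q < ∞ with q < p ≤ 1, and let u, v, w be weights on (a,b). Then there exists a finite constant C > 0 such that the inequality (∫_a^b (∫_a^x f(s) u(s) ds)^q w(x) dx)^{1/q} ≤ C (∫_a^b f(x)^p v(x) dx)^{1/p} holds for all non-decreasing f ∈ 𝔐↑(a,b) if and only if both 𝒞₂ := (∫_a^b (∫_x^b w)^{q/(p-q)} w(x) · ess sup_{t∈(a,x)} (∫_t^x u)^{pq/(p-q)} (∫_t^b v)^{-q/(p-q)} dx)^{(p-q)/(pq)} < ∞ and 𝒞₃ := (∫_a^b (∫_x^b w(s) (∫_x^s u)^q ds)^{q/(p-q)} w(x) · ess sup_{t∈(a,x)} (∫_t^x u)^q (∫_t^b v)^{-q/(p-q)} dx)^{(p-q)/(pq)} < ∞. Moreover, the best constant C in the inequality satisfies C ≈ 𝒞₂ + 𝒞₃. -/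

import Mathlib

open MeasureTheory Set ENNReal

noncomputable section

/-- The open interval `(a, b)` with extended-real endpoints, viewed as a set of reals. -/
def io (a b : EReal) : Set ℝ := {x : ℝ | a < (x : EReal) ∧ (x : EReal) < b}

/-- A weight on `(a, b)`: a measurable function which is positive and finite on `(a, b)`. -/
def IsWeight (a b : EReal) (u : ℝ → ℝ≥0∞) : Prop :=
  Measurable u ∧ ∀ x ∈ io a b, 0 < u x ∧ u x < ⊤

/-- The left-hand side of the Hardy inequality for non-decreasing functions. -/
def lhsMon (a b : EReal) (q : ℝ) (u w f : ℝ → ℝ≥0∞) : ℝ≥0∞ :=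
  (∫⁻ x in io a b, (∫⁻ s in io a x, f s * u s) ^ q * w x) ^ (1 / q)

/-- The right-hand side (without the constant) of the inequality. -/
def rhsNorm (a b : EReal) (p : ℝ) (v f : ℝ → ℝ≥0∞) : ℝ≥0∞ :=
  (∫⁻ x in io a b, f x ^ p * v x) ^ (1 / p)

/-- The best constant in the Hardy inequality restricted to non-negative
non-decreasing functions. -/
def bestMon (a b : EReal) (p q : ℝ) (u v w : ℝ → ℝ≥0∞) : ℝ≥0∞ :=
  sInf {C : ℝ≥0∞ | ∀ f : ℝ → ℝ≥0∞, Measurable f → MonotoneOn f (io a b) →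
    lhsMon a b q u w f ≤ C * rhsNorm a b p v f}

/-- The constant `𝒞₂`. -/
def CC2 (a b : EReal) (p q : ℝ) (u v w : ℝ → ℝ≥0∞) : ℝ≥0∞ :=
  (∫⁻ x in io a b, (∫⁻ t in io x b, w t) ^ (q / (p - q)) * w x *
      essSup (fun t : ℝ =>
          (∫⁻ s in io t x, u s) ^ (p * q / (p - q)) *
            (∫⁻ s in io t b, v s) ^ (-(q / (p - q))))
        (volume.restrict (io a x))) ^ ((p - q) / (p * q))

/-- The constant `𝒞₃`. -/
def CC3 (a b : EReal) (p q : ℝ) (u v w : ℝ → ℝ≥0∞) : ℝ≥0∞ :=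
  (∫⁻ x in io a b,
      (∫⁻ s in io x b, w s * (∫⁻ σ in io x s, u σ) ^ q) ^ (q / (p - q)) * w x *
      essSup (fun t : ℝ =>
          (∫⁻ s in io t x, u s) ^ q * (∫⁻ s in io t b, v s) ^ (-(q / (p - q))))
        (volume.restrict (io a x))) ^ ((p - q) / (p * q))

/-- The integral of `g` over `(s, t)`. -/
def mass (g : ℝ → ℝ≥0∞) (s t : EReal) : ℝ≥0∞ := ∫⁻ y in io s t, g y

lemma measurableSet_io (s t : EReal) : MeasurableSet (io s t) :=
  (measurableSet_lt measurable_const measurable_coe_real_ereal).inter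
    (measurableSet_lt measurable_coe_real_ereal measurable_const)

lemma io_subset_io {s s' t t' : EReal} (hs : s' ≤ s) (ht : t ≤ t') : io s t ⊆ io s' t' :=
  fun _ hx => ⟨hs.trans_lt hx.1, hx.2.trans_le ht⟩

lemma isOpen_io (s t : EReal) : IsOpen (io s t) :=
  (isOpen_lt continuous_const continuous_coe_real_ereal).inter
    (isOpen_lt continuous_coe_real_ereal continuous_const)

lemma io_nonempty {s t : EReal} (h : s < t) : (io s t).Nonempty := by
  obtain ⟨x, hx⟩ := EReal.lt_iff_exists_real_btwn.1 h
  exact ⟨x, hx⟩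

lemma setLIntegral_io_pos {g : ℝ → ℝ≥0∞} (hg : Measurable g) {s t : EReal} (h : s < t)
    (hpos : ∀ x ∈ io s t, 0 < g x) : 0 < ∫⁻ y in io s t, g y := by
  rw [setLIntegral_pos_iff hg]
  have : Function.support g ∩ io s t = io s t :=
    inter_eq_right.2 fun x hx => (hpos x hx).ne'
  rw [this]
  exact (isOpen_io s t).measure_pos _ (io_nonempty h)

lemma mass_pos {a b : EReal} {g : ℝ → ℝ≥0∞} (hg : IsWeight a b g) {s t : EReal} (h : s < t)
    (has : a ≤ s) (htb : t ≤ b) : 0 < mass g s t :=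
  setLIntegral_io_pos hg.1 h fun x hx => (hg.2 x (io_subset_io has htb hx)).1

lemma mass_mono (g : ℝ → ℝ≥0∞) {s s' t t' : EReal} (hs : s' ≤ s) (ht : t ≤ t') :
    mass g s t ≤ mass g s' t' :=
  lintegral_mono_set (io_subset_io hs ht)

lemma mass_eq_zero_of_le (g : ℝ → ℝ≥0∞) {s t : EReal} (h : t ≤ s) : mass g s t = 0 := by
  have : io s t = ∅ := by
    ext x
    simp only [io, mem_ofPred_eq, mem_empty_iff_false, iff_false, not_and, not_lt]
    exact fun hx => h.trans hx.le
  simp [mass, this]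

lemma mass_add (g : ℝ → ℝ≥0∞) {s t : EReal} (m : ℝ) (hs : s ≤ m) (ht : (m : EReal) ≤ t) :
    mass g s m + mass g m t = mass g s t := by
  have hd : Disjoint (io s m) (io m t) := by
    rw [Set.disjoint_left]
    exact fun x hx hx' => lt_asymm hx.2 hx'.1
  rw [mass, mass, ← lintegral_union (measurableSet_io _ _) hd, mass]
  apply setLIntegral_congr
  have : ({m}ᶜ : Set ℝ) ∈ ae (volume : Measure ℝ) := by
    rw [mem_ae_iff]; simp
  filter_upwards [this] with x hx
  have hxm : x ≠ m := hx
  apply propext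
  change (x ∈ io s m ∪ io m t) ↔ x ∈ io s t
  constructor
  · rintro (h | h)
    · exact ⟨h.1, h.2.trans_le ht⟩
    · exact ⟨hs.trans_lt h.1, h.2⟩
  · intro h
    rcases lt_or_gt_of_ne hxm with h' | h'
    · exact Or.inl ⟨h.1, by exact_mod_cast h'⟩
    · exact Or.inr ⟨by exact_mod_cast h', h.2⟩

lemma mass_le_add (g : ℝ → ℝ≥0∞) {s t : EReal} (m : ℝ) :
    mass g s t ≤ mass g s m + mass g m t := by
  rcases le_total s m with hs | hs
  · rcases le_total (m : EReal) t with ht | ht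
    · exact (mass_add g m hs ht).ge
    · exact (mass_mono g le_rfl ht).trans le_self_add
  · exact (mass_mono g hs le_rfl).trans le_add_self

lemma mass_le_of_forall_left (g : ℝ → ℝ≥0∞) {s t : EReal} {M : ℝ≥0∞}
    (h : ∀ c : ℝ, s < c → (c : EReal) < t → mass g c t ≤ M) : mass g s t ≤ M := by
  rcases le_or_gt t s with hst | hst
  · rw [mass_eq_zero_of_le g hst]; exact zero_le
  obtain ⟨c, hc, hmem, hlim⟩ := exists_seq_strictAnti_tendsto' hst
  have hU : io s t = ⋃ n, io (c n) t := by
    ext x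
    simp only [mem_iUnion]
    constructor
    · intro hx
      obtain ⟨n, hn⟩ := (hlim.eventually_lt_const hx.1).exists
      exact ⟨n, hn, hx.2⟩
    · rintro ⟨n, hn⟩
      exact ⟨(hmem n).1.trans hn.1, hn.2⟩
  rw [mass, hU, setLIntegral_iUnion_of_directed]
  · refine iSup_le fun n => ?_
    obtain ⟨r, hr⟩ : ∃ r : ℝ, (r : EReal) = c n :=
      ⟨_, EReal.coe_toReal ((hmem n).2.trans_le le_top).ne ((bot_le.trans_lt (hmem n).1).ne')⟩
    rw [← hr]
    exact h r (hr ▸ (hmem n).1) (hr ▸ (hmem n).2)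
  · exact (monotone_nat_of_le_succ fun n =>
      io_subset_io (hc.antitone (Nat.le_succ n)) le_rfl).directed_le

lemma mass_le_of_forall_right (g : ℝ → ℝ≥0∞) {s t : EReal} {M : ℝ≥0∞}
    (h : ∀ c : ℝ, s < c → (c : EReal) < t → mass g s c ≤ M) : mass g s t ≤ M := by
  rcases le_or_gt t s with hst | hst
  · rw [mass_eq_zero_of_le g hst]; exact zero_le
  obtain ⟨c, hc, hmem, hlim⟩ := exists_seq_strictMono_tendsto' hst
  have hU : io s t = ⋃ n, io s (c n) := by
    ext x
    simp only [mem_iUnion]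
    constructor
    · intro hx
      obtain ⟨n, hn⟩ := (hlim.eventually_const_lt hx.2).exists
      exact ⟨n, hx.1, hn⟩
    · rintro ⟨n, hn⟩
      exact ⟨hn.1, hn.2.trans (hmem n).2⟩
  rw [mass, hU, setLIntegral_iUnion_of_directed]
  · refine iSup_le fun n => ?_
    obtain ⟨r, hr⟩ : ∃ r : ℝ, (r : EReal) = c n :=
      ⟨_, EReal.coe_toReal ((hmem n).2.trans_le le_top).ne ((bot_le.trans_lt (hmem n).1).ne')⟩
    rw [← hr]
    exact h r (hr ▸ (hmem n).1) (hr ▸ (hmem n).2)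
  · exact (monotone_nat_of_le_succ fun n =>
      io_subset_io le_rfl (hc.monotone (Nat.le_succ n))).directed_le

lemma exists_mass_eq (g : ℝ → ℝ≥0∞) {b : EReal} {c : ℝ} (hc : mass g c b ≠ ⊤) {θ : ℝ≥0∞}
    (h0 : 0 < θ) (hθ : θ ≤ mass g c b) :
    ∃ x : ℝ, c ≤ x ∧ (x : EReal) < b ∧ mass g x b = θ := by
  have hcb : (c : EReal) < b := by
    by_contra hcon
    rw [mass_eq_zero_of_le g (not_lt.1 hcon)] at hθ
    exact absurd h0 (not_lt.2 hθ)
  have hθtop : θ ≠ ⊤ := ne_top_of_le_ne_top hc hθ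
  set A : Set ℝ := {x | c ≤ x ∧ (x : EReal) < b ∧ mass g x b ≤ θ} with hA
  have hne : A.Nonempty := by
    by_contra hcon
    have hlt : ∀ x : ℝ, c ≤ x → (x : EReal) < b → θ < mass g x b := by
      intro x hx hxb
      by_contra hx'
      exact hcon ⟨x, hx, hxb, not_lt.1 hx'⟩
    have : mass g c b ≤ mass g c b - θ := by
      refine mass_le_of_forall_right g fun x hx hxb => ?_
      have hx' : c ≤ x := by exact_mod_cast hx.le
      refine ENNReal.le_sub_of_add_le_right hθtop ?_
      rw [← mass_add g x hx.le hxb.le]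
      gcongr
      exact (hlt x hx' hxb).le
    exact absurd this (not_le.2 (ENNReal.sub_lt_self hc (h0.trans_le hθ).ne' h0.ne'))
  have hbdd : BddBelow A := ⟨c, fun x hx => hx.1⟩
  have hcx : c ≤ sInf A := le_csInf hne fun x hx => hx.1
  have hxb : ((sInf A : ℝ) : EReal) < b := by
    obtain ⟨y, hy⟩ := hne
    exact lt_of_le_of_lt (by exact_mod_cast csInf_le hbdd hy) hy.2.1
  refine ⟨sInf A, hcx, hxb, le_antisymm ?_ ?_⟩
  · refine mass_le_of_forall_left g fun y hy hyb => ?_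
    obtain ⟨z, hz, hzy⟩ := exists_lt_of_csInf_lt hne (by exact_mod_cast hy : sInf A < y)
    exact (mass_mono g (by exact_mod_cast hzy.le) le_rfl).trans hz.2.2
  · have h1 : mass g c (sInf A : ℝ) ≤ mass g c b - θ := by
      refine mass_le_of_forall_right g fun x hx hxA => ?_
      have hx' : c ≤ x := by exact_mod_cast hx.le
      have hxA' : x < sInf A := by exact_mod_cast hxA
      have hxb' := hxA.trans hxb
      refine ENNReal.le_sub_of_add_le_right hθtop ?_
      rw [← mass_add g x hx.le hxb'.le]
      gcongr
      by_contra hcon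
      exact absurd (csInf_le hbdd ⟨hx', hxb', (not_le.1 hcon).le⟩) (not_le.2 hxA')
    have h2 := mass_add g (s := c) (t := b) (sInf A) (by exact_mod_cast hcx) hxb.le
    have h3 : mass g c (sInf A : ℝ) ≠ ⊤ :=
      ne_top_of_le_ne_top hc (mass_mono g le_rfl hxb.le)
    have h4 : mass g c (sInf A : ℝ) + θ ≤ mass g c (sInf A : ℝ) + mass g (sInf A : ℝ) b := by
      rw [h2]
      calc _ ≤ mass g c b - θ + θ := by gcongr
        _ = _ := tsub_add_cancel_of_le hθ
    exact (ENNReal.add_le_add_iff_left h3).1 h4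

lemma monotone_mass (g : ℝ → ℝ≥0∞) (s : EReal) : Monotone fun x : ℝ => mass g s x :=
  fun _ _ h => mass_mono g le_rfl (by exact_mod_cast h)

lemma antitone_mass (g : ℝ → ℝ≥0∞) (t : EReal) : Antitone fun x : ℝ => mass g x t :=
  fun _ _ h => mass_mono g (by exact_mod_cast h) le_rfl

lemma measurable_mass_right (g : ℝ → ℝ≥0∞) (s : EReal) : Measurable fun x : ℝ => mass g s x :=
  (monotone_mass g s).measurable

lemma measurable_mass_left (g : ℝ → ℝ≥0∞) (t : EReal) : Measurable fun x : ℝ => mass g x t :=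
  (antitone_mass g t).measurable

lemma mass_rpow_mul_le_of_forall_left (g : ℝ → ℝ≥0∞) {s t : EReal} {M k : ℝ≥0∞} {e : ℝ}
    (he : 0 < e) (hk : k ≠ ⊤)
    (h : ∀ c : ℝ, s < c → (c : EReal) < t → mass g c t ^ e * k ≤ M) :
    mass g s t ^ e * k ≤ M := by
  rcases eq_or_ne k 0 with rfl | hk0
  · simp
  rw [← ENNReal.le_div_iff_mul_le (Or.inl hk0) (Or.inl hk), ← ENNReal.le_rpow_inv_iff he]
  refine mass_le_of_forall_left g fun c hc hct => ?_
  rw [ENNReal.le_rpow_inv_iff he, ENNReal.le_div_iff_mul_le (Or.inl hk0) (Or.inl hk)]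
  exact h c hc hct

/-- The supremum over `t ≥ a` of `(∫_t^x u)^e (∫_t^b v)^(-α)`. -/
def hsup (a b : EReal) (u v : ℝ → ℝ≥0∞) (e α : ℝ) (x : ℝ) : ℝ≥0∞ :=
  ⨆ t : EReal, ⨆ _ : a ≤ t, mass u t x ^ e * mass v t b ^ (-α)

lemma le_hsup {a b : EReal} (u v : ℝ → ℝ≥0∞) (e α : ℝ) (x : ℝ) {t : EReal} (ht : a ≤ t) :
    mass u t x ^ e * mass v t b ^ (-α) ≤ hsup a b u v e α x :=
  le_iSup₂_of_le t ht le_rfl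

lemma monotone_hsup (a b : EReal) (u v : ℝ → ℝ≥0∞) {e : ℝ} (α : ℝ) (he : 0 < e) :
    Monotone (hsup a b u v e α) := fun x y hxy =>
  iSup₂_mono fun t _ => by
    gcongr
    exact monotone_mass u t hxy

lemma mass_rpow_neg_ne_top {a b : EReal} {v : ℝ → ℝ≥0∞} (hv : IsWeight a b v) {α : ℝ}
    (hα : 0 < α) {t : EReal} (hat : a ≤ t) (htb : t < b) : mass v t b ^ (-α) ≠ ⊤ := by
  rw [ENNReal.rpow_neg]
  exact ENNReal.inv_ne_top.2
    (ENNReal.rpow_pos_of_nonneg (mass_pos hv htb hat le_rfl) hα.le).ne'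

lemma antitone_mass_rpow_neg (v : ℝ → ℝ≥0∞) {α : ℝ} (hα : 0 < α) {s t b : EReal} (h : s ≤ t) :
    mass v s b ^ (-α) ≤ mass v t b ^ (-α) := by
  rw [ENNReal.rpow_neg, ENNReal.rpow_neg, ENNReal.inv_le_inv]
  exact ENNReal.rpow_le_rpow (mass_mono v h le_rfl) hα.le

lemma essSup_eq_hsup {a b : EReal} (u : ℝ → ℝ≥0∞) {v : ℝ → ℝ≥0∞} (hv : IsWeight a b v)
    {e α : ℝ} (he : 0 < e) (hα : 0 < α) {x : ℝ} (hx : (x : EReal) < b) :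
    essSup (fun t : ℝ => mass u t x ^ e * mass v t b ^ (-α)) (volume.restrict (io a x)) =
      hsup a b u v e α x := by
  apply le_antisymm
  · refine essSup_le_of_ae_le _ ?_
    filter_upwards [ae_restrict_mem (measurableSet_io a x)] with t ht
    exact le_hsup u v e α x ht.1.le
  · set M := essSup (fun t : ℝ => mass u t x ^ e * mass v t b ^ (-α)) (volume.restrict (io a x))
    have hae : ∀ᵐ t : ℝ ∂(volume.restrict (io a x)),
        mass u t x ^ e * mass v t b ^ (-α) ≤ M :=
      ENNReal.ae_le_essSup _
    refine iSup₂_le fun t hat => ?_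
    rcases le_or_gt (x : EReal) t with hxt | htx
    · rw [mass_eq_zero_of_le u hxt, ENNReal.zero_rpow_of_pos he, zero_mul]
      exact zero_le
    refine mass_rpow_mul_le_of_forall_left u he (mass_rpow_neg_ne_top hv hα hat (htx.trans hx))
      fun c htc hcx => ?_
    have hpos : 0 < (volume : Measure ℝ) (io t c) := (isOpen_io t c).measure_pos _ (io_nonempty htc)
    rw [ae_restrict_iff' (measurableSet_io a x)] at hae
    obtain ⟨y, hy, hyM⟩ : ∃ y ∈ io t c, (y ∈ io a x →
        mass u y x ^ e * mass v y b ^ (-α) ≤ M) := by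
      by_contra! hcon
      have : io t c ⊆ {y : ℝ | ¬ (y ∈ io a x → mass u y x ^ e * mass v y b ^ (-α) ≤ M)} := by
        intro y hy
        have := hcon y hy
        change ¬ _
        push Not
        exact this
      exact hpos.ne' (measure_mono_null this hae)
    refine le_trans ?_ (hyM ⟨hat.trans_lt hy.1, hy.2.trans hcx⟩)
    exact mul_le_mul' (ENNReal.rpow_le_rpow (mass_mono u hy.2.le le_rfl) he.le)
      (antitone_mass_rpow_neg v hα hy.1.le)

/-- The inner kernel `∫_s^b w(y) (∫_t^y u)^q dy`. -/
def ker (b : EReal) (q : ℝ) (u w : ℝ → ℝ≥0∞) (t s : EReal) : ℝ≥0∞ :=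
  mass (fun y => w y * mass u t y ^ q) s b

lemma ker_mono {b : EReal} {q : ℝ} (hq : 0 < q) (u w : ℝ → ℝ≥0∞) {t t' s s' : EReal}
    (ht : t' ≤ t) (hs : s' ≤ s) : ker b q u w t s ≤ ker b q u w t' s' := by
  refine le_trans ?_ (mass_mono _ hs le_rfl)
  refine lintegral_mono fun y => ?_
  dsimp only
  gcongr
  exact mass_mono u ht le_rfl

lemma ker_pos {a b : EReal} {q : ℝ} {u w : ℝ → ℝ≥0∞} (hq : 0 < q) (hu : IsWeight a b u)
    (hw : IsWeight a b w) {t s : EReal} (hat : a ≤ t) (hts : t ≤ s) (hsb : s < b) :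
    0 < ker b q u w t s := by
  refine setLIntegral_io_pos (hw.1.mul ((measurable_mass_right u t).pow_const q)) hsb
    fun y hy => ?_
  have h1 := mass_pos hu (hts.trans_lt hy.1) hat hy.2.le
  have h2 := (hw.2 y ⟨(hat.trans hts).trans_lt hy.1, hy.2⟩).1
  exact ENNReal.mul_pos h2.ne' (ENNReal.rpow_pos_of_nonneg h1 hq.le).ne'

lemma ker_le_add {b : EReal} {q : ℝ} (hq : 0 < q) (hq1 : q ≤ 1) (u : ℝ → ℝ≥0∞)
    {w : ℝ → ℝ≥0∞} (hw : Measurable w) (t : EReal) (m : ℝ) (s : EReal) :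
    ker b q u w t s ≤ mass u t m ^ q * mass w s b + ker b q u w m s := by
  unfold ker mass
  rw [← lintegral_const_mul _ hw, ← lintegral_add_left (hw.const_mul _)]
  refine lintegral_mono fun y => ?_
  calc w y * mass u t y ^ q ≤ w y * (mass u t m + mass u m y) ^ q := by
        gcongr
        exact mass_le_add u m
    _ ≤ w y * (mass u t m ^ q + mass u m y ^ q) := by
        gcongr
        exact ENNReal.rpow_add_le_add_rpow _ _ hq.le hq1
    _ = _ := by rw [mul_add, mul_comm (w y)]; rfl

lemma ker_add {b : EReal} (q : ℝ) (u w : ℝ → ℝ≥0∞) (t : EReal) {s : EReal} (m : ℝ)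
    (hs : s ≤ m) (hm : (m : EReal) ≤ b) :
    (∫⁻ y in io s m, w y * mass u t y ^ q) + ker b q u w t m = ker b q u w t s :=
  mass_add _ m hs hm

lemma two_rpow_ne_top (α : ℝ) : (2 : ℝ≥0∞) ^ α ≠ ⊤ :=
  ENNReal.rpow_ne_top_of_ne_zero (by norm_num) (by norm_num)

/-- The density `(∫_x^b w)^α S₂ + K(x)^α S₃` of the two conditions together. -/
def hardyH (a b : EReal) (q α : ℝ) (u v w : ℝ → ℝ≥0∞) (x : ℝ) : ℝ≥0∞ :=
  mass w x b ^ α * hsup a b u v (q + q * α) α x + ker b q u w x x ^ α * hsup a b u v q α x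

lemma mass_rpow_mul_mass_le_hardyH {a b : EReal} (q α : ℝ) (u v w : ℝ → ℝ≥0∞) {t : EReal}
    (hat : a ≤ t) (x : ℝ) :
    mass w x b ^ α * (mass u t x ^ (q + q * α) * mass v t b ^ (-α)) ≤ hardyH a b q α u v w x :=
  (mul_le_mul_right (le_hsup u v _ α x hat) _).trans le_self_add

lemma ker_rpow_mul_mass_le_hardyH {a b : EReal} (q α : ℝ) (u v w : ℝ → ℝ≥0∞) {t : EReal}
    (hat : a ≤ t) (x : ℝ) :
    ker b q u w x x ^ α * (mass u t x ^ q * mass v t b ^ (-α)) ≤ hardyH a b q α u v w x :=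
  (mul_le_mul_right (le_hsup u v _ α x hat) _).trans le_add_self

lemma mass_mul_ker_le_hardyH {a b : EReal} {q α : ℝ} (hq : 0 < q) (hq1 : q ≤ 1) (hα : 0 < α)
    (u v : ℝ → ℝ≥0∞) {w : ℝ → ℝ≥0∞} (hw : Measurable w) {t : EReal} (hat : a ≤ t) (x : ℝ) :
    mass v t b ^ (-α) * mass u t x ^ q * ker b q u w t x ^ α ≤
      2 ^ α * hardyH a b q α u v w x := by
  set k := mass v t b ^ (-α)
  set U := mass u t x
  set W := mass w x b
  set K := ker b q u w x x
  calc k * U ^ q * ker b q u w t x ^ α ≤ k * U ^ q * (U ^ q * W + K) ^ α := by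
        gcongr
        exact ker_le_add hq hq1 u hw t x x
    _ ≤ k * U ^ q * (2 ^ α * ((U ^ q * W) ^ α + K ^ α)) := by
        gcongr
        exact ENNReal.add_rpow_le_two_rpow_mul_rpow_add_rpow _ _ hα.le
    _ = 2 ^ α * (W ^ α * (U ^ (q + q * α) * k) + K ^ α * (U ^ q * k)) := by
        rw [ENNReal.mul_rpow_of_nonneg _ _ hα.le, ← ENNReal.rpow_mul,
          ENNReal.rpow_add_of_nonneg _ _ hq.le (mul_pos hq hα).le]
        ring
    _ ≤ _ := by
        unfold hardyH
        gcongr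
        · exact le_hsup u v _ α x hat
        · exact le_hsup u v _ α x hat

lemma exists_mem_io_of_ae {a b : EReal} {P : ℝ → Prop}
    (hP : ∀ᵐ x ∂(volume : Measure ℝ), x ∈ io a b → P x) {s t : EReal} (has : a ≤ s)
    (hst : s < t) (htb : t ≤ b) : ∃ y ∈ io s t, P y := by
  by_contra! hcon
  have hpos : 0 < (volume : Measure ℝ) (io s t) := (isOpen_io s t).measure_pos _ (io_nonempty hst)
  refine hpos.ne' (measure_mono_null (fun y hy => ?_) (mem_ae_iff.1 hP))
  exact fun h => hcon y hy (h (io_subset_io has htb hy))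

lemma ne_top_of_mul_ne_top_left {x y : ℝ≥0∞} (h : x * y ≠ ⊤) (hy : y ≠ 0) : x ≠ ⊤ := by
  rintro rfl
  exact h (ENNReal.top_mul hy)

lemma finite_of_hardyH {a b : EReal} {q α : ℝ} (hq : 0 < q) (hq1 : q ≤ 1) (hα : 0 < α)
    {u v w : ℝ → ℝ≥0∞} (hu : IsWeight a b u) (hw : IsWeight a b w)
    (hH : ∀ᵐ x ∂(volume : Measure ℝ), x ∈ io a b → hardyH a b q α u v w x < ⊤)
    {t : EReal} (hat : a ≤ t) (hV : mass v t b ≠ ⊤) {s : ℝ} (hts : t < s) (hsb : (s : EReal) < b) :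
    ker b q u w t s ≠ ⊤ ∧ mass u t s ≠ ⊤ ∧ mass w s b ≠ ⊤ := by
  have hk : mass v t b ^ (-α) ≠ 0 := by
    rw [ENNReal.rpow_neg]
    exact ENNReal.inv_ne_zero.2 (ENNReal.rpow_ne_top_of_nonneg hα.le hV)
  have key : ∀ y : ℝ, t < y → (y : EReal) < b → hardyH a b q α u v w y < ⊤ →
      mass u t y ≠ ⊤ ∧ mass w y b ≠ ⊤ ∧ ker b q u w y y ≠ ⊤ := by
    intro y hty hyb hy
    have hU : mass u t y ≠ 0 := (mass_pos hu hty hat hyb.le).ne'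
    have hW : mass w y b ≠ 0 := (mass_pos hw hyb (hat.trans hty.le) le_rfl).ne'
    have hUp : ∀ e : ℝ, 0 < e → mass u t y ^ e ≠ 0 := fun e he h =>
      hU ((ENNReal.rpow_eq_zero_iff_of_pos he).1 h)
    have hqα : 0 < q + q * α := by positivity
    have h1 := ((mass_rpow_mul_mass_le_hardyH q α u v w hat y).trans_lt hy).ne
    have h2 := ((ker_rpow_mul_mass_le_hardyH q α u v w hat y).trans_lt hy).ne
    refine ⟨?_, ?_, ?_⟩
    · intro h
      rw [h, ENNReal.top_rpow_of_pos hqα, ENNReal.top_mul hk, ENNReal.mul_top] at h1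
      · exact h1 rfl
      · exact fun h => hW ((ENNReal.rpow_eq_zero_iff_of_pos hα).1 h)
    · exact fun h => ne_top_of_mul_ne_top_left h1 (mul_ne_zero (hUp _ hqα) hk)
        (by rw [h, ENNReal.top_rpow_of_pos hα])
    · exact fun h => ne_top_of_mul_ne_top_left h2 (mul_ne_zero (hUp _ hq) hk)
        (by rw [h, ENNReal.top_rpow_of_pos hα])
  obtain ⟨y, hy, hyH⟩ := exists_mem_io_of_ae hH hat hts hsb.le
  obtain ⟨z, hz, hzH⟩ := exists_mem_io_of_ae hH (hat.trans hts.le) hsb le_rfl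
  obtain ⟨hU, hW, hK⟩ := key y hy.1 (hy.2.trans hsb) hyH
  refine ⟨?_, ?_, ?_⟩
  · refine ne_top_of_le_ne_top ?_ ((ker_mono hq u w le_rfl hy.2.le).trans
      (ker_le_add hq hq1 u hw.1 t y y))
    exact ENNReal.add_ne_top.2
      ⟨ENNReal.mul_ne_top (ENNReal.rpow_ne_top_of_nonneg hq.le hU) hW, hK⟩
  · exact ne_top_of_le_ne_top (key z (hts.trans hz.1) hz.2 hzH).1 (mass_mono u le_rfl hz.1.le)
  · exact ne_top_of_le_ne_top hW (mass_mono w hy.2.le le_rfl)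

/-- The supremum controlling the weak-type weight in the sufficiency proof. -/
def hardyG (a b : EReal) (q α : ℝ) (u v w : ℝ → ℝ≥0∞) (x : ℝ) : ℝ≥0∞ :=
  ⨆ t : EReal, ⨆ _ : a ≤ t, ker b q u w t t ^ α * (mass v t b ^ (-α) * mass u t x ^ q)

/-- The integral remainder in the pointwise bound for `hardyG`. -/
def hardyJ (a b : EReal) (q α : ℝ) (u v w : ℝ → ℝ≥0∞) (x : ℝ) : ℝ≥0∞ :=
  ∫⁻ s in io a x, w s * hardyH a b q α u v w s *
    ((mass w s b)⁻¹ + mass u s x ^ q * (ker b q u w s s)⁻¹)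

lemma mass_rpow_mul_mass_le_ker {b : EReal} {q : ℝ} (hq : 0 < q) (u : ℝ → ℝ≥0∞)
    {w : ℝ → ℝ≥0∞} (hw : Measurable w) (t : EReal) (s : ℝ) :
    mass u t s ^ q * mass w s b ≤ ker b q u w t s := by
  unfold ker
  rw [mass, mass, ← lintegral_const_mul _ hw]
  refine setLIntegral_mono' (measurableSet_io _ _) fun y hy => ?_
  rw [mul_comm]
  gcongr
  exact mass_mono u le_rfl hy.1.le

lemma mul_inv_le_inv_of_mul_le {x y z : ℝ≥0∞} (hz0 : z ≠ 0) (hz : z ≠ ⊤) (hy0 : y ≠ 0)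
    (h : x * y ≤ z) : x * z⁻¹ ≤ y⁻¹ := by
  rw [← div_eq_mul_inv, ENNReal.div_le_iff hz0 hz, mul_comm, ← div_eq_mul_inv]
  rcases eq_or_ne y ⊤ with rfl | hy
  · rcases eq_or_ne x 0 with rfl | hx
    · exact zero_le
    · rw [ENNReal.mul_top hx] at h
      exact absurd (top_le_iff.1 h) hz
  · rwa [ENNReal.le_div_iff_mul_le (Or.inl hy0) (Or.inl hy)]

lemma hardyG_term_le {a b : EReal} {q α : ℝ} (hq : 0 < q) (hq1 : q ≤ 1) (hα : 0 < α)
    {u v w : ℝ → ℝ≥0∞} (hu : IsWeight a b u) (hw : IsWeight a b w)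
    (hH : ∀ᵐ x ∂(volume : Measure ℝ), x ∈ io a b → hardyH a b q α u v w x < ⊤)
    {t : EReal} (hat : a ≤ t) (hV : mass v t b ≠ ⊤) {t₁ x : ℝ} (htt : t < t₁) (htx : t₁ < x)
    (hxb : (x : EReal) < b) :
    ker b q u w t t₁ ^ α * (mass v t b ^ (-α) * mass u t x ^ q) ≤
      2 * (2 ^ α * 2 ^ α) * (hardyH a b q α u v w x + hardyJ a b q α u v w x) := by
  have htx' : (t₁ : EReal) < x := by exact_mod_cast htx
  have ht₁b : (t₁ : EReal) < b := htx'.trans hxb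
  obtain ⟨hK1, hU1, hW1⟩ := finite_of_hardyH hq hq1 hα hu hw hH hat hV htt ht₁b
  have hK0 : 0 < ker b q u w t t₁ := ker_pos hq hu hw hat htt.le ht₁b
  set K₁ := ker b q u w t t₁ with hK₁
  set k := mass v t b ^ (-α)
  set H := hardyH a b q α u v w
  have h2 : (1 : ℝ≥0∞) ≤ 2 := by norm_num
  rcases le_or_gt K₁ (2 * ker b q u w t x) with hc | hc
  · calc K₁ ^ α * (k * mass u t x ^ q)
        ≤ (2 * ker b q u w t x) ^ α * (k * mass u t x ^ q) := by gcongr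
      _ = 2 ^ α * (k * mass u t x ^ q * ker b q u w t x ^ α) := by
          rw [ENNReal.mul_rpow_of_nonneg _ _ hα.le]; ring
      _ ≤ 2 ^ α * (2 ^ α * H x) := by
          exact mul_le_mul_right (mass_mul_ker_le_hardyH hq hq1 hα u v hw.1 hat x) _
      _ = 1 * (2 ^ α * 2 ^ α) * (H x + 0) := by ring
      _ ≤ _ := by gcongr; exact zero_le
  obtain ⟨s₀, hs₁, hs₀b, hs₀⟩ := exists_mass_eq (fun y => w y * mass u t y ^ q) (b := b) (c := t₁)
    (θ := K₁ / 2) hK1 (ENNReal.half_pos hK0.ne') ENNReal.half_le_self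
  change ker b q u w t s₀ = K₁ / 2 at hs₀
  have hs₀x : s₀ ≤ x := by
    by_contra hcon
    have hxs : (x : EReal) ≤ s₀ := by exact_mod_cast (not_le.1 hcon).le
    have h1 := ker_mono (b := b) hq u w (le_refl t) hxs
    rw [hs₀] at h1
    refine absurd hc (not_lt.2 ?_)
    calc K₁ = 2 * (K₁ / 2) := (ENNReal.mul_div_cancel (by norm_num) (by norm_num)).symm
      _ ≤ _ := by gcongr
  have hI : (∫⁻ y in io t₁ s₀, w y * mass u t y ^ q) = K₁ / 2 := by
    have h1 := ker_add (b := b) q u w t (s := t₁) s₀ (by exact_mod_cast hs₁) hs₀b.le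
    rw [hs₀, ← hK₁] at h1
    have h3 : K₁ / 2 ≠ ⊤ := (ENNReal.div_lt_top hK1 (by norm_num)).ne
    refine (ENNReal.add_left_inj h3).1 ?_
    rw [h1, ENNReal.add_halves]
  have h1 : K₁ ^ α * (k * mass u t x ^ q) =
      ∫⁻ s in io t₁ s₀, (2 * K₁⁻¹ * (K₁ ^ α * (k * mass u t x ^ q))) *
        (w s * mass u t s ^ q) := by
    have hm : Measurable fun s : ℝ => w s * mass u t s ^ q :=
      hw.1.mul ((measurable_mass_right u t).pow_const q)
    rw [lintegral_const_mul _ hm, hI]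
    calc _ = (K₁ ^ α * (k * mass u t x ^ q)) * (2 * (K₁⁻¹ * (K₁ / 2))) := by
          rw [div_eq_mul_inv, ← mul_assoc K₁⁻¹, ENNReal.inv_mul_cancel hK0.ne' hK1, one_mul,
            ENNReal.mul_inv_cancel (by norm_num) (by norm_num), mul_one]
      _ = _ := by ring
  have hmeas : Measurable fun s : ℝ => w s * H s *
      ((mass w s b)⁻¹ + mass u s x ^ q * (ker b q u w s s)⁻¹) := by
    have hm1 : Measurable H := by
      refine (((measurable_mass_left w b).pow_const α).mul
        (monotone_hsup a b u v α (by positivity)).measurable).add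
        ((Measurable.pow_const ?_ α).mul (monotone_hsup a b u v α hq).measurable)
      exact Antitone.measurable fun s s' h =>
        ker_mono hq u w (by exact_mod_cast h) (by exact_mod_cast h)
    have hm2 : Measurable fun s : ℝ => ker b q u w s s :=
      Antitone.measurable fun s s' h =>
        ker_mono hq u w (by exact_mod_cast h) (by exact_mod_cast h)
    exact (hw.1.mul hm1).mul ((measurable_mass_left w b).inv.add
      (((measurable_mass_left u x).pow_const q).mul hm2.inv))
  have h3 : K₁ ^ α * (k * mass u t x ^ q) ≤
      2 * (2 ^ α * 2 ^ α) * hardyJ a b q α u v w x := by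
    rw [h1, hardyJ, ← lintegral_const_mul _ hmeas]
    refine (setLIntegral_mono' (measurableSet_io _ _) fun s hs => ?_).trans
      (lintegral_mono_set (io_subset_io (hat.trans htt.le) (by exact_mod_cast hs₀x)))
    have hts : t < s := htt.trans hs.1
    have hsb : (s : EReal) < b := hs.2.trans hs₀b
    have has : a ≤ s := hat.trans hts.le
    have hKs : K₁ ≤ 2 * ker b q u w t s := by
      calc K₁ = 2 * (K₁ / 2) := (ENNReal.mul_div_cancel (by norm_num) (by norm_num)).symm
        _ ≤ _ := by
          rw [← hs₀]
          gcongr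
          exact ker_mono hq u w le_rfl hs.2.le
    have hKs' : ker b q u w t s ≤ K₁ := ker_mono hq u w le_rfl hs.1.le
    set A := mass u t s ^ q
    have e1 : mass u t x ^ q ≤ A + mass u s x ^ q :=
      (ENNReal.rpow_le_rpow (mass_le_add u s) hq.le).trans
        (ENNReal.rpow_add_le_add_rpow _ _ hq.le hq1)
    have e2 : A * K₁⁻¹ ≤ (mass w s b)⁻¹ :=
      mul_inv_le_inv_of_mul_le hK0.ne' hK1 (mass_pos hw hsb has le_rfl).ne'
        ((mass_rpow_mul_mass_le_ker hq u hw.1 t s).trans hKs')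
    have e3 : K₁⁻¹ ≤ (ker b q u w s s)⁻¹ :=
      ENNReal.inv_le_inv.2 ((ker_mono hq u w hts.le le_rfl).trans hKs')
    calc 2 * K₁⁻¹ * (K₁ ^ α * (k * mass u t x ^ q)) * (w s * A)
        ≤ 2 * K₁⁻¹ * ((2 * ker b q u w t s) ^ α * (k * (A + mass u s x ^ q))) * (w s * A) := by
          gcongr
      _ = 2 * 2 ^ α * (w s * (k * A * ker b q u w t s ^ α) *
            (A * K₁⁻¹ + mass u s x ^ q * K₁⁻¹)) := by
          rw [ENNReal.mul_rpow_of_nonneg _ _ hα.le]; ring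
      _ ≤ 2 * 2 ^ α * (w s * (2 ^ α * H s) *
            ((mass w s b)⁻¹ + mass u s x ^ q * (ker b q u w s s)⁻¹)) := by
          exact mul_le_mul_right (mul_le_mul' (mul_le_mul_right
            (mass_mul_ker_le_hardyH hq hq1 hα u v hw.1 hat s) _)
            (add_le_add e2 (mul_le_mul_right e3 _))) _
      _ = _ := by ring
  exact h3.trans (mul_le_mul_right le_add_self _)

lemma hardyG_le {a b : EReal} {q α : ℝ} (hq : 0 < q) (hq1 : q ≤ 1) (hα : 0 < α)
    {u v w : ℝ → ℝ≥0∞} (hu : IsWeight a b u) (hv : IsWeight a b v) (hw : IsWeight a b w)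
    (hH : ∀ᵐ x ∂(volume : Measure ℝ), x ∈ io a b → hardyH a b q α u v w x < ⊤)
    {x : ℝ} (hxb : (x : EReal) < b) :
    hardyG a b q α u v w x ≤
      2 * (2 ^ α * 2 ^ α) * (hardyH a b q α u v w x + hardyJ a b q α u v w x) := by
  refine iSup₂_le fun t hat => ?_
  rcases le_or_gt (x : EReal) t with hxt | htx
  · rw [mass_eq_zero_of_le u hxt, ENNReal.zero_rpow_of_pos hq, mul_zero, mul_zero]
    exact zero_le
  rcases eq_or_ne (mass v t b) ⊤ with hV | hV
  · rw [hV, ENNReal.top_rpow_of_neg (by linarith), zero_mul, mul_zero]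
    exact zero_le
  refine mass_rpow_mul_le_of_forall_left _ hα ?_ fun c htc hcb => ?_
  · refine ENNReal.mul_ne_top (mass_rpow_neg_ne_top hv hα hat (htx.trans hxb)) ?_
    exact ENNReal.rpow_ne_top_of_nonneg hq.le
      (finite_of_hardyH hq hq1 hα hu hw hH hat hV htx hxb).2.1
  · obtain ⟨d, htd, hd⟩ := EReal.lt_iff_exists_real_btwn.1 (lt_min htc htx)
    have hdx : d < x := by exact_mod_cast hd.trans_le (min_le_right _ _)
    refine le_trans ?_ (hardyG_term_le hq hq1 hα hu hw hH hat hV htd hdx hxb)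
    gcongr
    exact mass_mono _ (hd.le.trans (min_le_left _ _)) le_rfl

lemma measurable_mass_prod {g : ℝ → ℝ≥0∞} (hg : Measurable g) :
    Measurable fun z : ℝ × ℝ => mass g z.1 z.2 := by
  have h : (fun z : ℝ × ℝ => mass g z.1 z.2) =
      fun z : ℝ × ℝ => ∫⁻ y, if z.1 < y ∧ y < z.2 then g y else 0 := by
    funext z
    rw [mass, ← lintegral_indicator (measurableSet_io _ _)]
    refine lintegral_congr fun y => ?_
    classical
    rw [indicator_apply]
    refine if_congr ?_ rfl rfl
    exact and_congr EReal.coe_lt_coe_iff EReal.coe_lt_coe_iff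
  rw [h]
  have hm : Measurable fun z : (ℝ × ℝ) × ℝ =>
      if z.1.1 < z.2 ∧ z.2 < z.1.2 then g z.2 else 0 := by
    refine Measurable.ite ?_ (hg.comp measurable_snd) measurable_const
    exact (measurableSet_lt measurable_fst.fst measurable_snd).inter
      (measurableSet_lt measurable_snd measurable_fst.snd)
  exact hm.lintegral_prod_right'

lemma lintegral_io_swap (a b : EReal) {F : ℝ → ℝ → ℝ≥0∞}
    (hF : Measurable fun z : ℝ × ℝ => F z.1 z.2) :
    ∫⁻ x in io a b, ∫⁻ s in io a x, F x s = ∫⁻ s in io a b, ∫⁻ x in io s b, F x s := by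
  have h1 : ∀ x ∈ io a b, ∫⁻ s in io a x, F x s =
      ∫⁻ s in io a b, if s < x then F x s else 0 := by
    intro x hx
    rw [← lintegral_indicator (measurableSet_io _ _), ← lintegral_indicator (measurableSet_io _ _)]
    refine lintegral_congr fun s => ?_
    by_cases hs : s ∈ io a x
    · have hsx : s < x := by exact_mod_cast hs.2
      rw [indicator_of_mem hs, indicator_of_mem (io_subset_io le_rfl hx.2.le hs), if_pos hsx]
    · rw [indicator_of_notMem hs]
      by_cases hs' : s ∈ io a b
      · have hsx : ¬ s < x := fun h => hs ⟨hs'.1, by exact_mod_cast h⟩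
        rw [indicator_of_mem hs', if_neg hsx]
      · rw [indicator_of_notMem hs']
  have h2 : ∀ s ∈ io a b, ∫⁻ x in io s b, F x s =
      ∫⁻ x in io a b, if s < x then F x s else 0 := by
    intro s hs
    rw [← lintegral_indicator (measurableSet_io _ _), ← lintegral_indicator (measurableSet_io _ _)]
    refine lintegral_congr fun x => ?_
    by_cases hx : x ∈ io s b
    · have hsx : s < x := by exact_mod_cast hx.1
      rw [indicator_of_mem hx, indicator_of_mem (io_subset_io hs.1.le le_rfl hx), if_pos hsx]
    · rw [indicator_of_notMem hx]
      by_cases hx' : x ∈ io a b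
      · have hsx : ¬ s < x := fun h => hx ⟨by exact_mod_cast h, hx'.2⟩
        rw [indicator_of_mem hx', if_neg hsx]
      · rw [indicator_of_notMem hx']
  rw [setLIntegral_congr_fun (measurableSet_io a b) h1,
    setLIntegral_congr_fun (measurableSet_io a b) h2]
  refine lintegral_lintegral_swap (Measurable.aemeasurable ?_)
  exact Measurable.ite (measurableSet_lt measurable_snd measurable_fst) hF measurable_const

lemma measurable_ker_diag (b : EReal) {q : ℝ} (hq : 0 < q) (u w : ℝ → ℝ≥0∞) :
    Measurable fun s : ℝ => ker b q u w s s :=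
  Antitone.measurable fun s s' h =>
    ker_mono hq u w (by exact_mod_cast h) (by exact_mod_cast h)

lemma measurable_hardyH (a b : EReal) {q α : ℝ} (hq : 0 < q) (hα : 0 < α) (u v w : ℝ → ℝ≥0∞) :
    Measurable (hardyH a b q α u v w) :=
  (((measurable_mass_left w b).pow_const α).mul
    (monotone_hsup a b u v α (by positivity)).measurable).add
    (((measurable_ker_diag b hq u w).pow_const α).mul (monotone_hsup a b u v α hq).measurable)

lemma lintegral_hardyJ_le (a b : EReal) {q α : ℝ} (hq : 0 < q) (hα : 0 < α)
    {u : ℝ → ℝ≥0∞} (v : ℝ → ℝ≥0∞) {w : ℝ → ℝ≥0∞} (hu : Measurable u) (hw : Measurable w) :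
    ∫⁻ x in io a b, w x * hardyJ a b q α u v w x ≤
      2 * ∫⁻ x in io a b, w x * hardyH a b q α u v w x := by
  have hH := measurable_hardyH a b hq hα u v w
  have hK := measurable_ker_diag b hq u w
  have hm : Measurable fun z : ℝ × ℝ => w z.2 * hardyH a b q α u v w z.2 *
      ((mass w z.2 b)⁻¹ + mass u z.2 z.1 ^ q * (ker b q u w z.2 z.2)⁻¹) := by
    refine ((hw.mul hH).comp measurable_snd).mul
      (((measurable_mass_left w b).inv.comp measurable_snd).add (Measurable.mul ?_
        (hK.inv.comp measurable_snd)))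
    exact ((measurable_mass_prod hu).comp measurable_swap).pow_const q
  have h1 : ∀ x : ℝ, w x * hardyJ a b q α u v w x = ∫⁻ s in io a x,
      w x * (w s * hardyH a b q α u v w s *
      ((mass w s b)⁻¹ + mass u s x ^ q * (ker b q u w s s)⁻¹)) := by
    intro x
    rw [hardyJ, lintegral_const_mul]
    exact hm.comp (measurable_const.prodMk measurable_id)
  simp_rw [h1]
  rw [lintegral_io_swap a b (F := fun x s => w x * (w s * hardyH a b q α u v w s *
      ((mass w s b)⁻¹ + mass u s x ^ q * (ker b q u w s s)⁻¹)))
      ((hw.comp measurable_fst).mul hm)]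
  have hm4 : Measurable fun x => w x * hardyH a b q α u v w x := hw.mul hH
  rw [← lintegral_const_mul _ hm4]
  refine lintegral_mono fun s => ?_
  have h2 : ∀ x : ℝ, w x * (w s * hardyH a b q α u v w s *
      ((mass w s b)⁻¹ + mass u s x ^ q * (ker b q u w s s)⁻¹)) =
      w s * hardyH a b q α u v w s * (w x * (mass w s b)⁻¹ +
        w x * mass u s x ^ q * (ker b q u w s s)⁻¹) := fun x => by ring
  have hm3 : Measurable fun x : ℝ => w x * mass u s x ^ q :=
    hw.mul ((measurable_mass_right u s).pow_const q)
  have hm5 : Measurable fun x : ℝ => w x * (mass w s b)⁻¹ +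
      w x * mass u s x ^ q * (ker b q u w s s)⁻¹ := (hw.mul_const _).add (hm3.mul_const _)
  simp_rw [h2]
  rw [lintegral_const_mul _ hm5,
    lintegral_add_left (hw.mul_const _), lintegral_mul_const _ hw, lintegral_mul_const _ hm3]
  calc _ ≤ w s * hardyH a b q α u v w s * (1 + 1) := by
        gcongr
        · exact ENNReal.mul_inv_le_one (mass w s b)
        · exact ENNReal.mul_inv_le_one (ker b q u w s s)
    _ = _ := by ring

lemma ae_lt_top_of_lintegral_weight {a b : EReal} {w h : ℝ → ℝ≥0∞} (hw : IsWeight a b w)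
    (hh : Measurable h) (hfin : ∫⁻ x in io a b, w x * h x ≠ ⊤) :
    ∀ᵐ x ∂(volume : Measure ℝ), x ∈ io a b → h x < ⊤ := by
  rw [← ae_restrict_iff' (measurableSet_io a b)]
  filter_upwards [ae_lt_top (hw.1.mul hh) hfin, ae_restrict_mem (measurableSet_io a b)] with x hx hxm
  by_contra hcon
  rw [not_lt, top_le_iff] at hcon
  simp only [Pi.mul_apply, hcon, ENNReal.mul_top (hw.2 x hxm).1.ne', lt_self_iff_false] at hx

lemma lintegral_hardyG_le {a b : EReal} {q α : ℝ} (hq : 0 < q) (hq1 : q ≤ 1) (hα : 0 < α)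
    {u v w : ℝ → ℝ≥0∞} (hu : IsWeight a b u) (hv : IsWeight a b v) (hw : IsWeight a b w)
    (hfin : ∫⁻ x in io a b, w x * hardyH a b q α u v w x ≠ ⊤) :
    ∫⁻ x in io a b, w x * hardyG a b q α u v w x ≤
      6 * (2 ^ α * 2 ^ α) * ∫⁻ x in io a b, w x * hardyH a b q α u v w x := by
  have hHm := measurable_hardyH a b hq hα u v w
  have hH := ae_lt_top_of_lintegral_weight hw hHm hfin
  have hm : Measurable fun x => w x * hardyH a b q α u v w x := hw.1.mul hHm
  calc ∫⁻ x in io a b, w x * hardyG a b q α u v w x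
      ≤ ∫⁻ x in io a b, 2 * (2 ^ α * 2 ^ α) *
          (w x * hardyH a b q α u v w x + w x * hardyJ a b q α u v w x) := by
        refine setLIntegral_mono' (measurableSet_io _ _) fun x hx => ?_
        refine (mul_le_mul_right (hardyG_le hq hq1 hα hu hv hw hH hx.2) (w x)).trans_eq ?_
        ring
    _ = 2 * (2 ^ α * 2 ^ α) * ((∫⁻ x in io a b, w x * hardyH a b q α u v w x) +
          ∫⁻ x in io a b, w x * hardyJ a b q α u v w x) := by
        rw [lintegral_const_mul', lintegral_add_left hm]
        exact ENNReal.mul_ne_top (by norm_num)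
          (ENNReal.mul_ne_top (two_rpow_ne_top α) (two_rpow_ne_top α))
    _ ≤ 2 * (2 ^ α * 2 ^ α) * ((∫⁻ x in io a b, w x * hardyH a b q α u v w x) +
          2 * ∫⁻ x in io a b, w x * hardyH a b q α u v w x) := by
        gcongr
        exact lintegral_hardyJ_le a b hq hα v hu.1 hw.1
    _ = _ := by ring

lemma monotone_hardyG (a b : EReal) {q : ℝ} (α : ℝ) (hq : 0 < q) (u v w : ℝ → ℝ≥0∞) :
    Monotone (hardyG a b q α u v w) := fun x y hxy =>
  iSup₂_mono fun t _ => by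
    gcongr
    exact monotone_mass u t hxy

lemma lintegral_mass_rpow_hardyG_le {a b : EReal} {p q α : ℝ} (hq : 0 < q) (hq1 : q ≤ 1)
    (hα : 0 < α) (hp : p = q + q / α) {u v w : ℝ → ℝ≥0∞} (hu : IsWeight a b u)
    (hv : IsWeight a b v) (hw : IsWeight a b w)
    (hfin : ∫⁻ x in io a b, w x * hardyH a b q α u v w x ≠ ⊤) {t : EReal} (hat : a ≤ t) :
    ∫⁻ x in io a b, mass u t x ^ p * hardyG a b q α u v w x ^ (-(1 / α)) * w x ≤
      mass v t b := by
  have hp0 : 0 < p := by rw [hp]; positivity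
  rcases eq_or_ne (mass v t b) ⊤ with hV | hV
  · rw [hV]; exact le_top
  rcases le_or_gt b t with hbt | htb
  · refine le_trans (le_of_eq ?_) zero_le
    rw [setLIntegral_congr_fun (measurableSet_io a b) (g := fun _ => 0)]
    · simp
    · intro x hx
      simp only
      rw [mass_eq_zero_of_le u (hx.2.le.trans hbt), ENNReal.zero_rpow_of_pos hp0, zero_mul,
        zero_mul]
  have hV0 : mass v t b ≠ 0 := (mass_pos hv htb hat le_rfl).ne'
  have hHm := measurable_hardyH a b hq hα u v w
  have hH := ae_lt_top_of_lintegral_weight hw hHm hfin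
  set V := mass v t b
  set K := ker b q u w t t with hK
  have hK0 : K ≠ 0 := (ker_pos hq hu hw hat le_rfl htb).ne'
  have hm : Measurable fun s : ℝ => w s * mass u t s ^ q :=
    hw.1.mul ((measurable_mass_right u t).pow_const q)
  have hKt : K ≠ ⊤ := by
    have h1 : K ^ α * V ^ (-α) * K ≤ ∫⁻ x in io a b, w x * hardyG a b q α u v w x := by
      rw [hK, ker, mass, ← lintegral_const_mul _ hm]
      refine le_trans ?_ (lintegral_mono_set (io_subset_io hat le_rfl))
      refine lintegral_mono fun x => ?_
      calc _ = w x * (K ^ α * (V ^ (-α) * mass u t x ^ q)) := by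
            change K ^ α * V ^ (-α) * (w x * mass u t x ^ q) = _
            ring
        _ ≤ _ := by
            gcongr
            exact le_iSup₂_of_le t hat le_rfl
    intro hcon
    rw [hcon, ENNReal.top_rpow_of_pos hα, ENNReal.top_mul, ENNReal.top_mul_top, top_le_iff] at h1
    · refine (ENNReal.mul_ne_top ?_ hfin) (top_le_iff.1 (h1 ▸ lintegral_hardyG_le hq hq1 hα hu hv hw hfin))
      exact ENNReal.mul_ne_top (by norm_num)
          (ENNReal.mul_ne_top (two_rpow_ne_top α) (two_rpow_ne_top α))
    · exact (ENNReal.rpow_pos hV0.bot_lt hV).ne'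
  have hpt : ∀ x ∈ io a b, mass u t x ^ p * hardyG a b q α u v w x ^ (-(1 / α)) * w x ≤
      (io t b).indicator (fun x => V * K⁻¹ * (w x * mass u t x ^ q)) x := by
    intro x hx
    by_cases hxt : x ∈ io t b
    · rw [indicator_of_mem hxt]
      set U := mass u t x
      have hU0 : U ≠ 0 := (mass_pos hu hxt.1 hat hx.2.le).ne'
      have hUt : U ≠ ⊤ := (finite_of_hardyH hq hq1 hα hu hw hH hat hV hxt.1 hxt.2).2.1
      have hG : K ^ α * (V ^ (-α) * U ^ q) ≤ hardyG a b q α u v w x :=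
        le_iSup₂_of_le t hat le_rfl
      have h2 : hardyG a b q α u v w x ^ (-(1 / α)) ≤ V * K⁻¹ * U ^ (-(q / α)) := by
        calc _ ≤ (K ^ α * (V ^ (-α) * U ^ q)) ^ (-(1 / α)) := by
              rw [ENNReal.rpow_neg, ENNReal.rpow_neg, ENNReal.inv_le_inv]
              exact ENNReal.rpow_le_rpow hG (by positivity)
          _ = _ := by
              have e1 : α * -(1 / α) = -1 := by field_simp
              have e2 : -α * -(1 / α) = 1 := by field_simp
              have e3 : q * -(1 / α) = -(q / α) := by field_simp
              rw [ENNReal.mul_rpow_of_ne_zero, ENNReal.mul_rpow_of_ne_zero, ← ENNReal.rpow_mul,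
                ← ENNReal.rpow_mul, ← ENNReal.rpow_mul, e1, e2, e3, ENNReal.rpow_one,
                ENNReal.rpow_neg_one]
              · ring
              · exact (ENNReal.rpow_pos hV0.bot_lt hV).ne'
              · exact (ENNReal.rpow_pos hU0.bot_lt hUt).ne'
              · exact (ENNReal.rpow_pos hK0.bot_lt hKt).ne'
              · exact mul_ne_zero (ENNReal.rpow_pos hV0.bot_lt hV).ne'
                  (ENNReal.rpow_pos hU0.bot_lt hUt).ne'
      calc U ^ p * hardyG a b q α u v w x ^ (-(1 / α)) * w x
          ≤ U ^ p * (V * K⁻¹ * U ^ (-(q / α))) * w x := by gcongr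
        _ = V * K⁻¹ * (w x * (U ^ p * U ^ (-(q / α)))) := by ring
        _ = _ := by
            rw [← ENNReal.rpow_add _ _ hU0 hUt]
            have : p + -(q / α) = q := by rw [hp]; ring
            rw [this]
    · have hxt' : (x : EReal) ≤ t := by
        by_contra hcon
        exact hxt ⟨not_le.1 hcon, hx.2⟩
      rw [mass_eq_zero_of_le u hxt', ENNReal.zero_rpow_of_pos hp0, zero_mul, zero_mul]
      exact zero_le
  refine (setLIntegral_mono' (measurableSet_io _ _) hpt).trans ?_
  refine (setLIntegral_le_lintegral _ _).trans ?_
  rw [lintegral_indicator (measurableSet_io _ _), lintegral_const_mul _ hm]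
  change V * K⁻¹ * K ≤ V
  rw [mul_assoc, ENNReal.inv_mul_cancel hK0 hKt, mul_one]

lemma finset_sum_rpow_le {ι : Type*} {p : ℝ} (hp : 0 < p) (hp1 : p ≤ 1) (g : ι → ℝ≥0∞)
    (s : Finset ι) : (∑ i ∈ s, g i) ^ p ≤ ∑ i ∈ s, g i ^ p := by
  classical
  induction s using Finset.induction_on with
  | empty => simp [ENNReal.zero_rpow_of_pos hp]
  | insert i s hi ih =>
    rw [Finset.sum_insert hi, Finset.sum_insert hi]
    exact (ENNReal.rpow_add_le_add_rpow _ _ hp.le hp1).trans (add_le_add_right ih _)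

lemma tsum_rpow_le {ι : Type*} {p : ℝ} (hp : 0 < p) (hp1 : p ≤ 1) (g : ι → ℝ≥0∞) :
    (∑' i, g i) ^ p ≤ ∑' i, g i ^ p := by
  have h := (ENNReal.continuous_rpow_const (y := p)).tendsto (∑' i, g i)
  exact le_of_tendsto (h.comp ENNReal.summable.hasSum)
    (Filter.Eventually.of_forall fun s =>
      (finset_sum_rpow_le hp hp1 g s).trans (ENNReal.sum_le_tsum s))

lemma le_tsum_dyadic (y : ℝ≥0∞) :
    y ≤ ∑' k : ℤ, if (2 : ℝ≥0∞) ^ k < y then (2 : ℝ≥0∞) ^ (k + 1) else 0 := by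
  rcases eq_or_ne y 0 with rfl | hy0
  · exact zero_le
  rcases eq_or_ne y ⊤ with rfl | hyt
  · have h : ∀ k : ℤ, (2 : ℝ≥0∞) ^ k < ⊤ := fun k =>
      ENNReal.zpow_lt_top (by norm_num) (by norm_num) k
    simp_rw [if_pos (h _)]
    refine (ENNReal.tsum_const_eq_top_of_ne_zero (α := ℕ) (one_ne_zero)).symm.le.trans ?_
    refine le_trans ?_ (ENNReal.tsum_comp_le_tsum_of_injective (f := fun n : ℕ => (n : ℤ))
      Nat.cast_injective _)
    refine ENNReal.tsum_le_tsum fun n => ?_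
    exact_mod_cast one_le_pow₀ (n := n + 1) (by norm_num : (1 : ℝ≥0∞) ≤ 2)
  · obtain ⟨n, hn⟩ := ENNReal.exists_mem_Ioc_zpow hy0 hyt (y := 2) (by norm_num) (by norm_num)
    refine le_trans ?_ (ENNReal.le_tsum n)
    rw [if_pos hn.1]
    exact hn.2

lemma tsum_dyadic_rpow_le {p : ℝ} (hp : 0 < p) (y : ℝ≥0∞) :
    (∑' k : ℤ, if (2 : ℝ≥0∞) ^ k < y then ((2 : ℝ≥0∞) ^ (k + 1)) ^ p else 0) ≤
      2 ^ p * (1 - 2 ^ (-p))⁻¹ * y ^ p := by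
  have hc : (1 - (2 : ℝ≥0∞) ^ (-p))⁻¹ ≠ 0 :=
    ENNReal.inv_ne_zero.2 (ENNReal.sub_ne_top (by norm_num))
  have h2p : (2 : ℝ≥0∞) ^ p ≠ 0 := (ENNReal.rpow_pos (by norm_num) (by norm_num)).ne'
  rcases eq_or_ne y 0 with rfl | hy0
  · simp
  rcases eq_or_ne y ⊤ with rfl | hyt
  · rw [ENNReal.top_rpow_of_pos hp, ENNReal.mul_top (mul_ne_zero h2p hc)]
    exact le_top
  obtain ⟨n, hn⟩ := ENNReal.exists_mem_Ioc_zpow hy0 hyt (y := 2) (by norm_num) (by norm_num)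
  have hinj : Function.Injective fun j : ℕ => n - (j : ℤ) := fun i j h => by
    simpa using h
  rw [← hinj.tsum_eq]
  · have hterm : ∀ j : ℕ, (if (2 : ℝ≥0∞) ^ (n - (j : ℤ)) < y then
        ((2 : ℝ≥0∞) ^ (n - (j : ℤ) + 1)) ^ p else 0) ≤
          2 ^ p * ((2 : ℝ≥0∞) ^ n) ^ p * (2 ^ (-p)) ^ j := by
      intro j
      split_ifs
      · refine le_of_eq ?_
        simp_rw [← ENNReal.rpow_intCast, ← ENNReal.rpow_natCast, ← ENNReal.rpow_mul]
        rw [← ENNReal.rpow_add _ _ (by norm_num) (by norm_num),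
          ← ENNReal.rpow_add _ _ (by norm_num) (by norm_num)]
        congr 1
        push_cast
        ring
      · exact zero_le
    refine (ENNReal.tsum_le_tsum hterm).trans ?_
    rw [ENNReal.tsum_mul_left, ENNReal.tsum_geometric]
    calc _ = 2 ^ p * (1 - 2 ^ (-p))⁻¹ * ((2 : ℝ≥0∞) ^ n) ^ p := by ring
      _ ≤ _ := by
        gcongr
        exact hn.1.le
  · intro k hk
    have hk' : (2 : ℝ≥0∞) ^ k < y := by
      by_contra hcon
      rw [Function.mem_support, if_neg hcon] at hk
      exact hk rfl
    have hkn : k < n + 1 := by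
      by_contra hcon
      have := ENNReal.zpow_le_of_le (x := 2) (by norm_num) (not_lt.1 hcon)
      exact absurd (hk'.trans_le (hn.2.trans this)) (lt_irrefl _)
    exact ⟨(n - k).toNat, by simp only; rw [Int.toNat_of_nonneg (by omega)]; ring⟩

/-- A superlevel set of a monotone function is, up to a point, an interval with right endpoint `b`. -/
lemma exists_superlevel_endpoint {a b : EReal} {f : ℝ → ℝ≥0∞} (hf : MonotoneOn f (io a b))
    (c : ℝ≥0∞) : ∃ t : EReal, a ≤ t ∧ (∀ x ∈ io t b, c < f x) ∧
      ∀ x ∈ io a b, c < f x → t ≤ x := by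
  refine ⟨sInf ((fun x : ℝ => (x : EReal)) '' {x | x ∈ io a b ∧ c < f x}), ?_, ?_, ?_⟩
  · refine le_sInf ?_
    rintro _ ⟨x, hx, rfl⟩
    exact hx.1.1.le
  · intro x hx
    obtain ⟨_, ⟨y, hy, rfl⟩, hyx⟩ := sInf_lt_iff.1 hx.1
    have hyx' : y ≤ x := EReal.coe_le_coe_iff.1 hyx.le
    exact hy.2.trans_le (hf hy.1 ⟨hy.1.1.trans hyx, hx.2⟩ hyx')
  · exact fun x hx hc => sInf_le ⟨x, ⟨hx, hc⟩, rfl⟩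

lemma lintegral_superlevel_le (u : ℝ → ℝ≥0∞) {a b : EReal} {f : ℝ → ℝ≥0∞} {c : ℝ≥0∞} {t : EReal}
    (ht : ∀ x ∈ io a b, c < f x → t ≤ x) {x : ℝ} (hx : (x : EReal) < b) :
    ∫⁻ y in io a x, (if c < f y then u y else 0) ≤ mass u t x := by
  have h1 : ∀ y ∈ io a x, (if c < f y then u y else 0) ≤
      (io t x ∪ {t.toReal}).indicator u y := by
    intro y hy
    split_ifs with hc
    · have hty := ht y (io_subset_io le_rfl hx.le hy) hc
      rw [indicator_of_mem]
      rcases eq_or_lt_of_le hty with h | h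
      · right
        rw [h]
        simp
      · exact Or.inl ⟨h, hy.2⟩
    · exact zero_le
  refine (setLIntegral_mono' (measurableSet_io _ _) h1).trans
    ((setLIntegral_le_lintegral _ _).trans ?_)
  rw [lintegral_indicator ((measurableSet_io _ _).union (measurableSet_singleton _))]
  refine (lintegral_union_le _ _ _).trans ?_
  simp [mass]

lemma lintegral_hardy_weak_le {a b : EReal} {p q α : ℝ} (hp0 : 0 < p) (hp1 : p ≤ 1)
    (hq : 0 < q) (hq1 : q ≤ 1) (hα : 0 < α) (hp : p = q + q / α) {u v w : ℝ → ℝ≥0∞}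
    (hu : IsWeight a b u) (hv : IsWeight a b v) (hw : IsWeight a b w)
    (hfin : ∫⁻ x in io a b, w x * hardyH a b q α u v w x ≠ ⊤) {f : ℝ → ℝ≥0∞}
    (hfm : Measurable f) (hf : MonotoneOn f (io a b)) :
    ∫⁻ x in io a b, mass (fun s => f s * u s) a x ^ p *
        hardyG a b q α u v w x ^ (-(1 / α)) * w x ≤
      2 ^ p * (1 - 2 ^ (-p))⁻¹ * ∫⁻ x in io a b, f x ^ p * v x := by
  choose t hat htE htb using fun k : ℤ => exists_superlevel_endpoint hf ((2 : ℝ≥0∞) ^ k)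
  have hset : ∀ k : ℤ, MeasurableSet {y | (2 : ℝ≥0∞) ^ k < f y} := fun k =>
    measurableSet_lt measurable_const hfm
  have hM : ∀ x ∈ io a b, mass (fun s => f s * u s) a x ≤
      ∑' k : ℤ, (2 : ℝ≥0∞) ^ (k + 1) * mass u (t k) x := by
    intro x hx
    calc mass (fun s => f s * u s) a x
        ≤ ∫⁻ y in io a x, ∑' k : ℤ, (2 : ℝ≥0∞) ^ (k + 1) *
            (if (2 : ℝ≥0∞) ^ k < f y then u y else 0) := by
          refine lintegral_mono fun y => ?_
          calc f y * u y ≤ (∑' k : ℤ, if (2 : ℝ≥0∞) ^ k < f y then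
                (2 : ℝ≥0∞) ^ (k + 1) else 0) * u y := by
                gcongr
                exact le_tsum_dyadic (f y)
            _ = _ := by
                rw [← ENNReal.tsum_mul_right]
                refine tsum_congr fun k => ?_
                split_ifs <;> simp
      _ = ∑' k : ℤ, (2 : ℝ≥0∞) ^ (k + 1) * ∫⁻ y in io a x,
            (if (2 : ℝ≥0∞) ^ k < f y then u y else 0) := by
          have hm : ∀ k : ℤ, Measurable fun y => if (2 : ℝ≥0∞) ^ k < f y then u y else 0 :=
            fun k => Measurable.ite (hset k) hu.1 measurable_const
          rw [lintegral_tsum fun k => ((hm k).const_mul _).aemeasurable]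
          exact tsum_congr fun k => lintegral_const_mul _ (hm k)
      _ ≤ _ := by
          refine ENNReal.tsum_le_tsum fun k => ?_
          gcongr
          exact lintegral_superlevel_le u (htb k) hx.2
  have hψ : Measurable fun x => hardyG a b q α u v w x ^ (-(1 / α)) :=
    (monotone_hardyG a b α hq u v w).measurable.pow_const _
  calc _ ≤ ∫⁻ x in io a b, ∑' k : ℤ, ((2 : ℝ≥0∞) ^ (k + 1)) ^ p *
          (mass u (t k) x ^ p * hardyG a b q α u v w x ^ (-(1 / α)) * w x) := by
        refine setLIntegral_mono' (measurableSet_io _ _) fun x hx => ?_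
        calc _ ≤ (∑' k : ℤ, ((2 : ℝ≥0∞) ^ (k + 1)) ^ p * mass u (t k) x ^ p) *
              hardyG a b q α u v w x ^ (-(1 / α)) * w x := by
              gcongr
              refine (ENNReal.rpow_le_rpow (hM x hx) hp0.le).trans
                ((tsum_rpow_le hp0 hp1 _).trans_eq ?_)
              exact tsum_congr fun k => ENNReal.mul_rpow_of_nonneg _ _ hp0.le
          _ = _ := by
              rw [← ENNReal.tsum_mul_right, ← ENNReal.tsum_mul_right]
              exact tsum_congr fun k => by ring
    _ = ∑' k : ℤ, ((2 : ℝ≥0∞) ^ (k + 1)) ^ p * ∫⁻ x in io a b,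
          (mass u (t k) x ^ p * hardyG a b q α u v w x ^ (-(1 / α)) * w x) := by
        have hm : ∀ k : ℤ, Measurable fun x : ℝ =>
            mass u (t k) x ^ p * hardyG a b q α u v w x ^ (-(1 / α)) * w x := fun k =>
          (((measurable_mass_right u (t k)).pow_const p).mul hψ).mul hw.1
        rw [lintegral_tsum fun k => ((hm k).const_mul _).aemeasurable]
        exact tsum_congr fun k => lintegral_const_mul _ (hm k)
    _ ≤ ∑' k : ℤ, ((2 : ℝ≥0∞) ^ (k + 1)) ^ p * ∫⁻ x in io a b,
          (if (2 : ℝ≥0∞) ^ k < f x then v x else 0) := by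
        refine ENNReal.tsum_le_tsum fun k => ?_
        refine mul_le_mul_right ?_ _
        refine (lintegral_mass_rpow_hardyG_le hq hq1 hα hp hu hv hw hfin (hat k)).trans ?_
        refine le_trans ?_ (lintegral_mono_set (io_subset_io (hat k) le_rfl))
        exact setLIntegral_mono' (measurableSet_io _ _) fun x hx => by rw [if_pos (htE k x hx)]
    _ = ∫⁻ x in io a b, ∑' k : ℤ, ((2 : ℝ≥0∞) ^ (k + 1)) ^ p *
          (if (2 : ℝ≥0∞) ^ k < f x then v x else 0) := by
        have hm : ∀ k : ℤ, Measurable fun y => if (2 : ℝ≥0∞) ^ k < f y then v y else 0 :=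
          fun k => Measurable.ite (hset k) hv.1 measurable_const
        rw [lintegral_tsum fun k => ((hm k).const_mul _).aemeasurable]
        exact tsum_congr fun k => (lintegral_const_mul _ (hm k)).symm
    _ ≤ ∫⁻ x in io a b, 2 ^ p * (1 - 2 ^ (-p))⁻¹ * (f x ^ p * v x) := by
        refine lintegral_mono fun x => ?_
        calc _ = (∑' k : ℤ, if (2 : ℝ≥0∞) ^ k < f x then ((2 : ℝ≥0∞) ^ (k + 1)) ^ p else 0) *
              v x := by
              rw [← ENNReal.tsum_mul_right]
              refine tsum_congr fun k => ?_
              split_ifs <;> simp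
          _ ≤ 2 ^ p * (1 - 2 ^ (-p))⁻¹ * f x ^ p * v x := by
              gcongr
              exact tsum_dyadic_rpow_le hp0 (f x)
          _ = _ := by ring
    _ = _ := lintegral_const_mul _ ((hfm.pow_const p).mul hv.1)

/-- The constant obtained in the sufficiency part. -/
def suffConst (p q : ℝ) : ℝ≥0∞ :=
  (2 ^ p * (1 - 2 ^ (-p))⁻¹) ^ (1 / p) *
    (6 * (2 ^ (q / (p - q)) * 2 ^ (q / (p - q)))) ^ ((p - q) / (p * q)) * 2 ^ ((p - q) / (p * q))

lemma dyadicConst_ne_top {p : ℝ} (hp : 0 < p) : (2 : ℝ≥0∞) ^ p * (1 - 2 ^ (-p))⁻¹ ≠ ⊤ := by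
  refine ENNReal.mul_ne_top (two_rpow_ne_top p) (ENNReal.inv_ne_top.2 ?_)
  exact (tsub_pos_of_lt (ENNReal.rpow_lt_one_of_one_lt_of_neg (by norm_num) (by linarith))).ne'

lemma suffConst_ne_top {p q : ℝ} (hq : 0 < q) (hqp : q < p) : suffConst p q ≠ ⊤ := by
  have hp : 0 < p := hq.trans hqp
  have he : 0 ≤ (p - q) / (p * q) := div_nonneg (by linarith) (by positivity)
  refine ENNReal.mul_ne_top (ENNReal.mul_ne_top ?_ ?_) (two_rpow_ne_top _)
  · exact ENNReal.rpow_ne_top_of_nonneg (by positivity) (dyadicConst_ne_top hp)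
  · exact ENNReal.rpow_ne_top_of_nonneg he (ENNReal.mul_ne_top (by norm_num)
      (ENNReal.mul_ne_top (two_rpow_ne_top _) (two_rpow_ne_top _)))

lemma lintegral_hardy_le {a b : EReal} {p q α : ℝ} (hp0 : 0 < p) (hp1 : p ≤ 1)
    (hq : 0 < q) (hqp : q < p) (hα : 0 < α) (hp : p = q + q / α) {u v w : ℝ → ℝ≥0∞}
    (hu : IsWeight a b u) (hv : IsWeight a b v) (hw : IsWeight a b w)
    (hfin : ∫⁻ x in io a b, w x * hardyH a b q α u v w x ≠ ⊤) {f : ℝ → ℝ≥0∞}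
    (hfm : Measurable f) (hf : MonotoneOn f (io a b))
    (hR : ∫⁻ x in io a b, f x ^ p * v x ≠ ⊤) :
    ∫⁻ x in io a b, mass (fun s => f s * u s) a x ^ q * w x ≤
      (2 ^ p * (1 - 2 ^ (-p))⁻¹ * ∫⁻ x in io a b, f x ^ p * v x) ^ (q / p) *
      (6 * (2 ^ α * 2 ^ α) * ∫⁻ x in io a b, w x * hardyH a b q α u v w x) ^ (1 - q / p) := by
  have hq1 : q ≤ 1 := hqp.le.trans hp1
  set M : ℝ → ℝ≥0∞ := fun x => mass (fun s => f s * u s) a x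
  set G := hardyG a b q α u v w
  have hGm : Measurable G := (monotone_hardyG a b α hq u v w).measurable
  have hMm : Measurable M := measurable_mass_right _ a
  have hr0 : 0 < q / p := by positivity
  have hr1 : 0 < 1 - q / p := by rw [sub_pos, div_lt_one hp0]; exact hqp
  have hweak := lintegral_hardy_weak_le hp0 hp1 hq hq1 hα hp hu hv hw hfin hfm hf
  have hG := lintegral_hardyG_le hq hq1 hα hu hv hw hfin
  have hψm : Measurable fun x => M x ^ p * G x ^ (-(1 / α)) * w x :=
    ((hMm.pow_const p).mul (hGm.pow_const _)).mul hw.1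
  have hwG : Measurable fun x => w x * G x := hw.1.mul hGm
  have hGfin : ∀ᵐ x ∂(volume : Measure ℝ), x ∈ io a b → G x < ⊤ :=
    ae_lt_top_of_lintegral_weight hw hGm (ne_top_of_le_ne_top (ENNReal.mul_ne_top
      (ENNReal.mul_ne_top (by norm_num) (ENNReal.mul_ne_top (two_rpow_ne_top _)
        (two_rpow_ne_top _))) hfin) hG)
  rw [← ae_restrict_iff' (measurableSet_io a b)] at hGfin
  have hMfin : ∀ᵐ x ∂(volume.restrict (io a b)), M x ^ p * G x ^ (-(1 / α)) * w x < ⊤ :=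
    ae_lt_top hψm (ne_top_of_le_ne_top (ENNReal.mul_ne_top (dyadicConst_ne_top hp0) hR) hweak)
  calc ∫⁻ x in io a b, M x ^ q * w x
      ≤ ∫⁻ x in io a b, (M x ^ p * G x ^ (-(1 / α)) * w x) ^ (q / p) *
          (w x * G x) ^ (1 - q / p) := by
        refine lintegral_mono_ae ?_
        filter_upwards [hGfin, hMfin, ae_restrict_mem (measurableSet_io a b)] with x hGx hMx hx
        obtain ⟨hw0, hwt⟩ := hw.2 x hx
        rcases eq_or_ne (G x) 0 with hG0 | hG0
        · have hM0 : M x = 0 := by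
            by_contra hcon
            have h1 : M x ^ p ≠ 0 := fun h => hcon ((ENNReal.rpow_eq_zero_iff_of_pos hp0).1 h)
            rw [hG0, ENNReal.zero_rpow_of_neg (by simpa using hα), ENNReal.mul_top h1,
              ENNReal.top_mul hw0.ne'] at hMx
            exact lt_irrefl _ hMx
          rw [hM0, ENNReal.zero_rpow_of_pos hq, zero_mul]
          exact zero_le
        · refine le_of_eq ?_
          have e1 : p * (q / p) = q := by field_simp
          have e2 : -(1 / α) * (q / p) + (1 - q / p) = 0 := by
            have : p ≠ 0 := hp0.ne'
            rw [hp] at this ⊢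
            field_simp
            ring
          rw [ENNReal.mul_rpow_of_nonneg _ _ hr0.le, ENNReal.mul_rpow_of_nonneg _ _ hr0.le,
            ENNReal.mul_rpow_of_nonneg _ _ hr1.le, ← ENNReal.rpow_mul, ← ENNReal.rpow_mul, e1]
          calc M x ^ q * w x = M x ^ q * (G x ^ (-(1 / α) * (q / p) + (1 - q / p))) *
                w x ^ (q / p + (1 - q / p)) := by
                rw [e2]; simp
            _ = _ := by
                rw [ENNReal.rpow_add _ _ hG0 hGx.ne, ENNReal.rpow_add _ _ hw0.ne' hwt.ne]
                ring
    _ ≤ (∫⁻ x in io a b, M x ^ p * G x ^ (-(1 / α)) * w x) ^ (q / p) *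
          (∫⁻ x in io a b, w x * G x) ^ (1 - q / p) :=
        ENNReal.lintegral_mul_norm_pow_le hψm.aemeasurable hwG.aemeasurable hr0.le hr1.le (by ring)
    _ ≤ _ := by gcongr

lemma lintegral_hardyH_eq {a b : EReal} {p q : ℝ} (hq : 0 < q) (hqp : q < p)
    {u v w : ℝ → ℝ≥0∞} (hv : IsWeight a b v) (hw : IsWeight a b w) :
    (∫⁻ x in io a b, w x * hardyH a b q (q / (p - q)) u v w x) =
      CC2 a b p q u v w ^ (p * q / (p - q)) + CC3 a b p q u v w ^ (p * q / (p - q)) := by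
  have hp : 0 < p := hq.trans hqp
  have hpq : 0 < p - q := by linarith
  have hα : 0 < q / (p - q) := by positivity
  have he : 0 < p * q / (p - q) := by positivity
  have e1 : q + q * (q / (p - q)) = p * q / (p - q) := by field_simp; ring
  have e2 : (p - q) / (p * q) * (p * q / (p - q)) = 1 := by field_simp
  rw [CC2, CC3, ← ENNReal.rpow_mul, ← ENNReal.rpow_mul, e2, ENNReal.rpow_one, ENNReal.rpow_one]
  have hm2 : Measurable fun x : ℝ => mass w x b ^ (q / (p - q)) * w x *
      hsup a b u v (p * q / (p - q)) (q / (p - q)) x :=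
    (((measurable_mass_left w b).pow_const _).mul hw.1).mul
      (monotone_hsup a b u v _ he).measurable
  have h2 : ∀ x ∈ io a b, (∫⁻ t in io x b, w t) ^ (q / (p - q)) * w x *
      essSup (fun t : ℝ => (∫⁻ s in io t x, u s) ^ (p * q / (p - q)) *
            (∫⁻ s in io t b, v s) ^ (-(q / (p - q)))) (volume.restrict (io a x)) =
      mass w x b ^ (q / (p - q)) * w x * hsup a b u v (p * q / (p - q)) (q / (p - q)) x :=
    fun x hx => congrArg _ (essSup_eq_hsup u hv he hα hx.2)
  have h3 : ∀ x ∈ io a b, (∫⁻ s in io x b, w s * (∫⁻ σ in io x s, u σ) ^ q) ^ (q / (p - q)) *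
      w x * essSup (fun t : ℝ => (∫⁻ s in io t x, u s) ^ q *
            (∫⁻ s in io t b, v s) ^ (-(q / (p - q)))) (volume.restrict (io a x)) =
      ker b q u w x x ^ (q / (p - q)) * w x * hsup a b u v q (q / (p - q)) x :=
    fun x hx => congrArg _ (essSup_eq_hsup u hv hq hα hx.2)
  rw [setLIntegral_congr_fun (measurableSet_io a b) h2,
    setLIntegral_congr_fun (measurableSet_io a b) h3, ← lintegral_add_left hm2]
  refine lintegral_congr fun x => ?_
  rw [hardyH, e1]
  ring

lemma lhsMon_le_of_finite {a b : EReal} {p q : ℝ} (hq : 0 < q) (hqp : q < p) (hp1 : p ≤ 1)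
    {u v w : ℝ → ℝ≥0∞} (hu : IsWeight a b u) (hv : IsWeight a b v) (hw : IsWeight a b w)
    (h2 : CC2 a b p q u v w ≠ ⊤) (h3 : CC3 a b p q u v w ≠ ⊤) {f : ℝ → ℝ≥0∞}
    (hfm : Measurable f) (hf : MonotoneOn f (io a b))
    (hR : rhsNorm a b p v f ≠ ⊤) :
    lhsMon a b q u w f ≤
      suffConst p q * (CC2 a b p q u v w + CC3 a b p q u v w) * rhsNorm a b p v f := by
  have hp : 0 < p := hq.trans hqp
  have hpq : 0 < p - q := by linarith
  have hα : 0 < q / (p - q) := by positivity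
  have he : 0 < p * q / (p - q) := by positivity
  have he' : 0 < (p - q) / (p * q) := by positivity
  have hR' : ∫⁻ x in io a b, f x ^ p * v x ≠ ⊤ := fun h => hR (by
    rw [rhsNorm, h, ENNReal.top_rpow_of_pos (by positivity)])
  have hX := lintegral_hardyH_eq (u := u) hq hqp hv hw
  have hfin : ∫⁻ x in io a b, w x * hardyH a b q (q / (p - q)) u v w x ≠ ⊤ := by
    rw [hX]
    exact ENNReal.add_ne_top.2 ⟨ENNReal.rpow_ne_top_of_nonneg he.le h2,
      ENNReal.rpow_ne_top_of_nonneg he.le h3⟩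
  have h := lintegral_hardy_le hp hp1 hq hqp hα (by field_simp; ring) hu hv hw hfin hfm hf hR'
  have e1 : q / p * (1 / q) = 1 / p := by field_simp
  have e2 : (1 - q / p) * (1 / q) = (p - q) / (p * q) := by field_simp
  have e3 : p * q / (p - q) * ((p - q) / (p * q)) = 1 := by field_simp
  refine (ENNReal.rpow_le_rpow h (by positivity : 0 ≤ 1 / q)).trans ?_
  rw [ENNReal.mul_rpow_of_nonneg _ _ (by positivity), ← ENNReal.rpow_mul, ← ENNReal.rpow_mul, e1, e2,
    ENNReal.mul_rpow_of_nonneg _ _ (by positivity), ENNReal.mul_rpow_of_nonneg _ _ he'.le, hX]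
  have hadd := ENNReal.add_rpow_le_two_rpow_mul_rpow_add_rpow
    (CC2 a b p q u v w ^ (p * q / (p - q))) (CC3 a b p q u v w ^ (p * q / (p - q))) he'.le
  rw [← ENNReal.rpow_mul, ← ENNReal.rpow_mul, e3, ENNReal.rpow_one, ENNReal.rpow_one] at hadd
  refine (mul_le_mul_right (mul_le_mul_right hadd _) _).trans_eq ?_
  rw [suffConst, rhsNorm]
  ring

/-- The Hardy inequality with constant `D`, in terms of the integrals themselves. -/
def HardyBound (a b : EReal) (p q : ℝ) (u v w : ℝ → ℝ≥0∞) (D : ℝ≥0∞) : Prop :=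
  ∀ f : ℝ → ℝ≥0∞, Measurable f → MonotoneOn f (io a b) →
    ∫⁻ x in io a b, mass (fun s => f s * u s) a x ^ q * w x ≤
      D * (∫⁻ x in io a b, f x ^ p * v x) ^ (q / p)

lemma HardyBound.of_lhsMon {a b : EReal} {p q : ℝ} (hq : 0 < q) {u v w : ℝ → ℝ≥0∞} {C : ℝ≥0∞}
    (h : ∀ f : ℝ → ℝ≥0∞, Measurable f → MonotoneOn f (io a b) →
      lhsMon a b q u w f ≤ C * rhsNorm a b p v f) : HardyBound a b p q u v w (C ^ q) := by
  intro f hfm hf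
  have h1 := ENNReal.rpow_le_rpow (h f hfm hf) hq.le
  have e1 : 1 / q * q = 1 := by field_simp
  have e2 : 1 / p * q = q / p := by ring
  rw [lhsMon, rhsNorm, ENNReal.mul_rpow_of_nonneg _ _ hq.le, ← ENNReal.rpow_mul,
    ← ENNReal.rpow_mul, e1, e2, ENNReal.rpow_one] at h1
  exact h1

/-- Testing the Hardy inequality on `p`-th roots of step functions. -/
lemma HardyBound.exists_test {a b : EReal} {p q : ℝ} (hp : 0 < p) (hq : 0 < q)
    {u v w : ℝ → ℝ≥0∞} (hu : Measurable u) (hv : Measurable v) {D : ℝ≥0∞}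
    (hD : HardyBound a b p q u v w D)
    (n : ℕ) (t : ℕ → EReal) (c : ℕ → ℝ≥0∞) :
    ∃ Φ : ℝ → ℝ≥0∞, Measurable Φ ∧ ∫⁻ x in io a b, Φ x * w x ≤
        D * (∑ i ∈ Finset.range n, c i * mass v (t i) b) ^ (q / p) ∧
      ∀ s ⊆ Finset.range n, ∀ τ : EReal, a ≤ τ → (∀ i ∈ s, t i ≤ τ) → ∀ x : ℝ,
        (x : EReal) < b → (∑ i ∈ s, c i) ^ (q / p) * mass u τ x ^ q ≤ Φ x := by
  set g : ℝ → ℝ≥0∞ := fun y => ∑ i ∈ Finset.range n, c i * (io (t i) b).indicator 1 y with hg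
  have hgm : Measurable g := Finset.measurable_sum _ fun i _ =>
    (measurable_one.indicator (measurableSet_io _ _)).const_mul _
  have hmono : MonotoneOn g (io a b) := by
    intro x _ y hy hxy
    refine Finset.sum_le_sum fun i _ => ?_
    gcongr
    by_cases hx : x ∈ io (t i) b
    · have hxy' : (x : EReal) ≤ y := by exact_mod_cast hxy
      rw [indicator_of_mem hx, indicator_of_mem (show y ∈ io (t i) b from
        ⟨hx.1.trans_le hxy', hy.2⟩)]
      exact le_rfl
    · rw [indicator_of_notMem hx]
      exact zero_le
  refine ⟨fun x => mass (fun s => g s ^ (1 / p) * u s) a x ^ q,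
    (measurable_mass_right _ a).pow_const q, ?_, ?_⟩
  · refine (hD (fun y => g y ^ (1 / p)) (hgm.pow_const _) fun x hx y hy hxy =>
      ENNReal.rpow_le_rpow (hmono hx hy hxy) (by positivity)).trans ?_
    gcongr
    have e1 : 1 / p * p = 1 := by field_simp
    simp_rw [← ENNReal.rpow_mul, e1, ENNReal.rpow_one, hg, Finset.sum_mul]
    have hm : ∀ i ∈ Finset.range n, Measurable fun x =>
        c i * (io (t i) b).indicator 1 x * v x := fun i _ =>
      ((measurable_one.indicator (measurableSet_io _ _)).const_mul _).mul hv
    rw [lintegral_finsetSum _ hm]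
    refine Finset.sum_le_sum fun i _ => ?_
    have h1 : ∀ x, c i * (io (t i) b).indicator 1 x * v x =
        c i * (io (t i) b).indicator v x := fun x => by
      by_cases hx : x ∈ io (t i) b <;> simp [hx]
    simp_rw [h1]
    rw [lintegral_const_mul _ (hv.indicator (measurableSet_io _ _))]
    gcongr
    refine (setLIntegral_le_lintegral _ _).trans ?_
    rw [lintegral_indicator (measurableSet_io _ _)]
    exact le_rfl
  · intro s hs τ haτ hτ x hx
    have e2 : q / p = 1 / p * q := by ring
    rw [e2, ENNReal.rpow_mul, ← ENNReal.mul_rpow_of_nonneg _ _ hq.le]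
    refine ENNReal.rpow_le_rpow ?_ hq.le
    refine le_trans ?_ (mass_mono _ haτ le_rfl)
    rw [mass, mass, ← lintegral_const_mul _ hu]
    refine setLIntegral_mono' (measurableSet_io _ _) fun y hy => ?_
    gcongr
    rw [hg]
    refine le_trans (Finset.sum_le_sum fun i hi => ?_)
      (Finset.sum_le_sum_of_subset hs (f := fun i => c i * (io (t i) b).indicator 1 y))
    rw [indicator_of_mem (show y ∈ io (t i) b from ⟨(hτ i hi).trans_lt hy.1, hy.2.trans hx⟩)]
    simp

lemma HardyBound.ker_le {a b : EReal} {p q : ℝ} (hp : 0 < p) (hq : 0 < q)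
    {u v w : ℝ → ℝ≥0∞} (hu : Measurable u) (hv : Measurable v) {D : ℝ≥0∞}
    (hD : HardyBound a b p q u v w D) {t : EReal} (hat : a ≤ t) :
    ker b q u w t t ≤ D * mass v t b ^ (q / p) := by
  obtain ⟨Φ, -, h1, h2⟩ := hD.exists_test hp hq hu hv 1 (fun _ => t) (fun _ => 1)
  simp only [Finset.range_one, Finset.sum_singleton, one_mul] at h1
  refine le_trans ?_ h1
  refine le_trans ?_ (lintegral_mono_set (io_subset_io hat le_rfl))
  refine setLIntegral_mono' (measurableSet_io _ _) fun y hy => ?_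
  rw [mul_comm]
  gcongr
  have := h2 {0} (by simp) t hat (by simp) y hy.2
  simpa using this

lemma HardyBound.finite {a b : EReal} {p q : ℝ} (hp : 0 < p) (hq : 0 < q)
    {u v w : ℝ → ℝ≥0∞} (hu : IsWeight a b u) (hv : IsWeight a b v) (hw : IsWeight a b w)
    {D : ℝ≥0∞} (hDt : D ≠ ⊤) (hD : HardyBound a b p q u v w D) {t : EReal} (hat : a ≤ t)
    (hV : mass v t b ≠ ⊤) : ker b q u w t t ≠ ⊤ ∧
      ∀ x : ℝ, t < x → (x : EReal) < b → mass u t x ≠ ⊤ ∧ mass w x b ≠ ⊤ := by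
  have hK : ker b q u w t t ≠ ⊤ := ne_top_of_le_ne_top
    (ENNReal.mul_ne_top hDt (ENNReal.rpow_ne_top_of_nonneg (by positivity) hV))
    (hD.ker_le hp hq hu.1 hv.1 hat)
  refine ⟨hK, fun x htx hxb => ?_⟩
  have h1 : mass u t x ^ q * mass w x b ≠ ⊤ := ne_top_of_le_ne_top hK
    ((mass_rpow_mul_mass_le_ker hq u hw.1 t x).trans (mass_mono _ htx.le le_rfl))
  have hW0 := (mass_pos hw hxb (hat.trans htx.le) le_rfl).ne'
  have hU0 := (mass_pos hu htx hat hxb.le).ne'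
  constructor
  · intro h
    refine ne_top_of_mul_ne_top_left h1 hW0 ?_
    rw [h, ENNReal.top_rpow_of_pos hq]
  · rw [mul_comm] at h1
    exact ne_top_of_mul_ne_top_left h1 fun h => hU0 ((ENNReal.rpow_eq_zero_iff_of_pos hq).1 h)

/-- An increasing sequence along which the tail mass of `w` is halved at each step. -/
structure IsGrid (b : EReal) (w : ℝ → ℝ≥0∞) (x : ℕ → ℝ) : Prop where
  mono : StrictMono x
  lt_right : ∀ k, (x k : EReal) < b
  half : ∀ k, 2 * mass w (x (k + 1)) b = mass w (x k) b
  finite : ∀ k, mass w (x k) b ≠ ⊤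
  cover : ∀ y : ℝ, x 0 ≤ y → (y : EReal) < b → ∃ k, x k ≤ y ∧ y < x (k + 1)

lemma exists_isGrid {a b : EReal} {w : ℝ → ℝ≥0∞} (hw : IsWeight a b w) {c : ℝ}
    (hac : a ≤ c) (hcb : (c : EReal) < b) (hfin : mass w c b ≠ ⊤) :
    ∃ x : ℕ → ℝ, x 0 = c ∧ IsGrid b w x := by
  set ω := mass w c b with hω
  have hω0 : ω ≠ 0 := (mass_pos hw hcb hac le_rfl).ne'
  have hex : ∀ k : ℕ, ∃ y : ℝ, c ≤ y ∧ (y : EReal) < b ∧ mass w y b = ω * 2⁻¹ ^ k ∧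
      (k = 0 → y = c) := by
    intro k
    rcases Nat.eq_zero_or_pos k with rfl | hk
    · exact ⟨c, le_rfl, hcb, by simp [hω], fun _ => rfl⟩
    · obtain ⟨y, h1, h2, h3⟩ := exists_mass_eq w hfin (θ := ω * 2⁻¹ ^ k)
        (ENNReal.mul_pos hω0 (pow_ne_zero _ (by norm_num)))
        (mul_le_of_le_one_right' (pow_le_one₀ (zero_le) (by norm_num)))
      exact ⟨y, h1, h2, h3, fun h => absurd h hk.ne'⟩
  choose x hcx hxb hx hx0 using hex
  have hhalf : ∀ k, 2 * mass w (x (k + 1)) b = mass w (x k) b := by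
    intro k
    rw [hx, hx, pow_succ]
    calc 2 * (ω * (2⁻¹ ^ k * 2⁻¹)) = ω * 2⁻¹ ^ k * (2 * 2⁻¹) := by ring
      _ = _ := by rw [ENNReal.mul_inv_cancel (by norm_num) (by norm_num), mul_one]
  have hfink : ∀ k, mass w (x k) b ≠ ⊤ := fun k =>
    ne_top_of_le_ne_top hfin (mass_mono w (by exact_mod_cast hcx k) le_rfl)
  have hposk : ∀ k, mass w (x k) b ≠ 0 := fun k =>
    (mass_pos hw (hxb k) (hac.trans (by exact_mod_cast hcx k)) le_rfl).ne'
  have hmono : StrictMono x := by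
    refine strictMono_nat_of_lt_succ fun k => ?_
    by_contra hcon
    have h1 := mass_mono w (t := b) (show (x (k + 1) : EReal) ≤ x k by
      exact_mod_cast not_lt.1 hcon) le_rfl
    rw [← hhalf k, two_mul] at h1
    exact absurd h1 (not_le.2 (ENNReal.lt_add_right (hfink _) (hposk _)))
  refine ⟨x, hx0 0 rfl, hmono, hxb, hhalf, hfink, fun y hy hyb => ?_⟩
  have hWy : mass w y b ≠ 0 := (mass_pos hw hyb (hac.trans (by
    rw [hx0 0 rfl] at hy; exact_mod_cast hy)) le_rfl).ne'
  have hlim : Filter.Tendsto (fun k : ℕ => ω * 2⁻¹ ^ k) Filter.atTop (nhds 0) := by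
    have := ENNReal.Tendsto.const_mul (a := ω)
      (ENNReal.tendsto_pow_atTop_nhds_zero_of_lt_one (r := 2⁻¹) (by norm_num)) (Or.inr hfin)
    simpa using this
  obtain ⟨k, hk⟩ := (hlim.eventually_lt_const hWy.bot_lt).exists
  have hex' : ∃ k, y < x k := by
    refine ⟨k, ?_⟩
    by_contra hcon
    have h1 := mass_mono w (t := b) (show (x k : EReal) ≤ y by
      exact_mod_cast not_lt.1 hcon) le_rfl
    rw [hx] at h1
    exact absurd hk (not_lt.2 h1)
  classical
  have hfs := Nat.find_spec hex'
  obtain ⟨m, hm⟩ : ∃ m, Nat.find hex' = m + 1 := by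
    refine Nat.exists_eq_succ_of_ne_zero fun h => ?_
    rw [h] at hfs
    exact absurd hfs (not_lt.2 hy)
  refine ⟨m, ?_, hm ▸ hfs⟩
  exact not_lt.1 (Nat.find_min hex' (by omega))

lemma sum_mass_grid (g : ℝ → ℝ≥0∞) {x : ℕ → ℝ} (hx : Monotone x) (n : ℕ) :
    ∑ j ∈ Finset.range n, mass g (x j) (x (j + 1)) = mass g (x 0) (x n) := by
  induction n with
  | zero => rw [Finset.sum_range_zero, mass_eq_zero_of_le g le_rfl]
  | succ n ih =>
    rw [Finset.sum_range_succ, ih]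
    exact mass_add g (x n) (by exact_mod_cast hx (Nat.zero_le n))
      (by exact_mod_cast hx (Nat.le_succ n))

lemma IsGrid.mass_block {b : EReal} {w : ℝ → ℝ≥0∞} {x : ℕ → ℝ} (hx : IsGrid b w x) (j : ℕ) :
    2 * mass w (x j) (x (j + 1)) = mass w (x j) b := by
  have h1 := mass_add w (s := x j) (t := b) (x (j + 1))
    (by exact_mod_cast hx.mono.monotone (Nat.le_succ j)) (hx.lt_right _).le
  rw [← hx.half j] at h1 ⊢
  rw [two_mul (mass w (x (j + 1)) b)] at h1
  rw [(ENNReal.add_left_inj (hx.finite _)).1 h1]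

lemma IsGrid.sum_le_lintegral {a b : EReal} {w : ℝ → ℝ≥0∞} {x : ℕ → ℝ} (hx : IsGrid b w x)
    (hw : Measurable w) (hax : a ≤ x 0) {Φ : ℝ → ℝ≥0∞} {e : ℕ → ℝ≥0∞} (n : ℕ)
    (he : ∀ j < n, ∀ y ∈ io (x (j + 1)) (x (j + 2)), e j ≤ Φ y) :
    ∑ j ∈ Finset.range n, mass w (x j) b * e j ≤ 4 * ∫⁻ y in io a b, Φ y * w y := by
  have h1 : ∑ j ∈ Finset.range n, mass (fun y => Φ y * w y) (x (j + 1)) (x (j + 2)) ≤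
      ∫⁻ y in io a b, Φ y * w y := by
    rw [sum_mass_grid _ (x := fun j => x (j + 1)) fun i j hij =>
      hx.mono.monotone (Nat.succ_le_succ hij)]
    exact mass_mono _ (hax.trans (by exact_mod_cast hx.mono.monotone (Nat.zero_le _)))
      (hx.lt_right _).le
  refine le_trans ?_ (mul_le_mul_right h1 4)
  rw [Finset.mul_sum]
  refine Finset.sum_le_sum fun j hj => ?_
  rw [← hx.half j, ← hx.mass_block (j + 1)]
  calc 2 * (2 * mass w (x (j + 1)) (x (j + 1 + 1))) * e j
      = 4 * ∫⁻ y in io (x (j + 1)) (x (j + 2)), e j * w y := by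
        rw [lintegral_const_mul _ hw]
        change _ = 4 * (e j * mass w (x (j + 1)) (x (j + 2)))
        ring
    _ ≤ _ := by
        refine mul_le_mul_right (setLIntegral_mono' (measurableSet_io _ _) fun y hy => ?_) _
        gcongr
        exact he j (Finset.mem_range.1 hj) y hy

lemma le_rpow_of_le_mul_rpow {T E : ℝ≥0∞} {r β : ℝ} (hβ : 0 ≤ β) (hr : β * (1 - r) = 1)
    (hT : T ≠ ⊤) (h : T ≤ E * T ^ r) : T ≤ E ^ β := by
  rcases eq_or_ne T 0 with rfl | hT0
  · exact zero_le
  have h1 : T ^ (1 - r) ≤ E := by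
    rw [ENNReal.rpow_sub _ _ hT0 hT, ENNReal.rpow_one]
    exact ENNReal.div_le_of_le_mul h
  calc T = (T ^ (1 - r)) ^ β := by rw [← ENNReal.rpow_mul, mul_comm, hr, ENNReal.rpow_one]
    _ ≤ E ^ β := by gcongr

lemma sum_iSup_add_le {ι : Type*} (S : ℕ → Set ι) (hS : ∀ k, (S k).Nonempty)
    (g : ℕ → ι → ℝ≥0∞) (n : ℕ) : ∀ A M : ℝ≥0∞,
      (∀ t : ℕ → ι, (∀ k, t k ∈ S k) → ∑ k ∈ Finset.range n, g k (t k) + A ≤ M) →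
      ∑ k ∈ Finset.range n, (⨆ i : S k, g k i) + A ≤ M := by
  induction n with
  | zero =>
    intro A M h
    simpa using h (fun k => (hS k).some) fun k => (hS k).some_mem
  | succ n ih =>
    intro A M h
    have : Nonempty (S n) := (hS n).to_subtype
    rw [Finset.sum_range_succ, add_assoc, ENNReal.iSup_add, ENNReal.add_iSup]
    refine iSup_le fun i => ih (g n i + A) M fun t ht => ?_
    have h1 := h (fun k => if k = n then i else t k) fun k => by
      split_ifs with hk
      · rw [hk]; exact i.2
      · exact ht k
    rw [Finset.sum_range_succ, if_pos rfl, add_assoc] at h1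
    convert h1 using 2
    refine Finset.sum_congr rfl fun k hk => ?_
    rw [if_neg (Finset.mem_range.1 hk).ne]

lemma sum_iSup_le {ι : Type*} (S : ℕ → Set ι) (hS : ∀ k, (S k).Nonempty)
    (g : ℕ → ι → ℝ≥0∞) (n : ℕ) {M : ℝ≥0∞}
    (h : ∀ t : ℕ → ι, (∀ k, t k ∈ S k) → ∑ k ∈ Finset.range n, g k (t k) ≤ M) :
    ∑ k ∈ Finset.range n, (⨆ i : S k, g k i) ≤ M := by
  simpa using sum_iSup_add_le S hS g n 0 M (by simpa using h)

lemma IsGrid.lintegral_le {b : EReal} {w : ℝ → ℝ≥0∞} {x : ℕ → ℝ} (hx : IsGrid b w x)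
    (hw : Measurable w) {g : ℝ → ℝ≥0∞} {e : ℕ → ℝ≥0∞}
    (h : ∀ k, ∀ y ∈ Ico (x k) (x (k + 1)), g y ≤ e k) :
    ∫⁻ y in io (x 0) b, w y * g y ≤ ∑' k, mass w (x k) b * e k := by
  have hsub : io (x 0) b ⊆ ⋃ k, Ico (x k) (x (k + 1)) := fun y hy => by
    obtain ⟨k, hk⟩ := hx.cover y (by exact_mod_cast hy.1.le) hy.2
    exact mem_iUnion.2 ⟨k, hk⟩
  refine (lintegral_mono_set hsub).trans ((lintegral_iUnion_le _ _).trans ?_)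
  refine ENNReal.tsum_le_tsum fun k => ?_
  calc _ ≤ ∫⁻ y in Ico (x k) (x (k + 1)), w y * e k := by
        refine setLIntegral_mono' measurableSet_Ico fun y hy => ?_
        gcongr
        exact h k y hy
    _ = (∫⁻ y in Ico (x k) (x (k + 1)), w y) * e k := lintegral_mul_const _ hw
    _ ≤ _ := by
        gcongr
        rw [← setLIntegral_congr (Ioo_ae_eq_Ico (a := x k) (b := x (k + 1)))]
        refine lintegral_mono_set fun y hy => ⟨by exact_mod_cast hy.1, ?_⟩
        exact lt_trans (by exact_mod_cast hy.2) (hx.lt_right (k + 1))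

lemma rpow_neg_eq_inv_rpow (x : ℝ≥0∞) (α : ℝ) : x ^ (-α) = x⁻¹ ^ α := by
  rw [ENNReal.rpow_neg, ENNReal.inv_rpow]

lemma HardyBound.term_ne_top {a b : EReal} {p q α e : ℝ} (hp : 0 < p) (hq : 0 < q) (hα : 0 < α)
    (he : 0 < e) {u v w : ℝ → ℝ≥0∞} (hu : IsWeight a b u) (hv : IsWeight a b v)
    (hw : IsWeight a b w) {D : ℝ≥0∞} (hDt : D ≠ ⊤) (hD : HardyBound a b p q u v w D)
    {t : EReal} (hat : a ≤ t) {x : ℝ} (hxb : (x : EReal) < b) :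
    mass u t x ^ e * mass v t b ^ (-α) ≠ ⊤ := by
  rcases le_or_gt (x : EReal) t with hxt | htx
  · rw [mass_eq_zero_of_le u hxt, ENNReal.zero_rpow_of_pos he, zero_mul]
    exact ENNReal.zero_ne_top
  rcases eq_or_ne (mass v t b) ⊤ with hV | hV
  · rw [hV, ENNReal.top_rpow_of_neg (by linarith), mul_zero]
    exact ENNReal.zero_ne_top
  · exact ENNReal.mul_ne_top (ENNReal.rpow_ne_top_of_nonneg he.le
      ((hD.finite hp hq hu hv hw hDt hat hV).2 x htx hxb).1)
      (mass_rpow_neg_ne_top hv hα hat (htx.trans hxb))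

lemma hsup_eq_iSup_subtype (a b : EReal) (u v : ℝ → ℝ≥0∞) (e α : ℝ) (x : ℝ) :
    hsup a b u v e α x = ⨆ t : Ici a, mass u t x ^ e * mass v t b ^ (-α) :=
  iSup_subtype'

lemma HardyBound.sum_hsup_le {a b : EReal} {p q α : ℝ} (hp : 0 < p) (hq : 0 < q) (hα : 0 < α)
    (hr : (α + 1) * (q / p) = α) {u v w : ℝ → ℝ≥0∞} (hu : IsWeight a b u) (hv : IsWeight a b v)
    (hw : IsWeight a b w) {D : ℝ≥0∞} (hDt : D ≠ ⊤) (hD : HardyBound a b p q u v w D)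
    {x : ℕ → ℝ} (hx : IsGrid b w x) (hax : a ≤ x 0) (n : ℕ) :
    ∑ k ∈ Finset.range n, mass w (x k) b *
      (mass w (x k) b ^ α * hsup a b u v (q + q * α) α (x (k + 1))) ≤ (4 * D) ^ (α + 1) := by
  have hr0 : 0 < q / p := by positivity
  have hqα : 0 < q + q * α := by positivity
  set z : ℕ → ℝ≥0∞ := fun k => mass w (x k) b
  have key : ∑ k ∈ Finset.range n, (⨆ t : Ici a, z k *
      (z k ^ α * (mass u t (x (k + 1)) ^ (q + q * α) * mass v t b ^ (-α)))) ≤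
        (4 * D) ^ (α + 1) := by
    refine sum_iSup_le (fun _ => Ici a) (fun _ => nonempty_Ici) (fun k t => z k *
      (z k ^ α * (mass u t (x (k + 1)) ^ (q + q * α) * mass v t b ^ (-α)))) n fun t ht => ?_
    set U : ℕ → ℝ≥0∞ := fun k => mass u (t k) (x (k + 1))
    set V : ℕ → ℝ≥0∞ := fun k => mass v (t k) b
    set c : ℕ → ℝ≥0∞ := fun k => z k * (z k ^ α * (U k ^ (q + q * α) * V k ^ (-α))) with hc
    have hT : ∑ k ∈ Finset.range n, c k ≠ ⊤ := ENNReal.sum_ne_top.2 fun k _ =>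
      ENNReal.mul_ne_top (hx.finite k) (ENNReal.mul_ne_top
        (ENNReal.rpow_ne_top_of_nonneg hα.le (hx.finite k))
        (hD.term_ne_top hp hq hα hqα hu hv hw hDt (ht k) (hx.lt_right _)))
    refine le_rpow_of_le_mul_rpow (r := q / p) (by positivity) (by linarith) hT ?_
    obtain ⟨Φ, -, h1, h2⟩ := hD.exists_test hp hq hu.1 hv.1 n t fun k => c k * (V k)⁻¹
    have hlow := hx.sum_le_lintegral (a := a) hw.1 hax (Φ := Φ)
      (e := fun k => (c k * (V k)⁻¹) ^ (q / p) * U k ^ q) n fun j hj y hy => by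
        have h3 := h2 {j} (by simpa using hj) (t j) (ht j) (by simp) y
          (hy.2.trans (hx.lt_right _))
        rw [Finset.sum_singleton] at h3
        refine le_trans ?_ h3
        gcongr
        exact mass_mono u le_rfl hy.1.le
    have heq : ∀ k, z k * ((c k * (V k)⁻¹) ^ (q / p) * U k ^ q) = c k := by
      intro k
      have e1 : z k * z k ^ α = z k ^ (α + 1) := by
        rw [ENNReal.rpow_add_of_nonneg _ _ hα.le zero_le_one, ENNReal.rpow_one, mul_comm]
      have e2 : (V k)⁻¹ ^ α * (V k)⁻¹ = (V k)⁻¹ ^ (α + 1) := by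
        rw [ENNReal.rpow_add_of_nonneg _ _ hα.le zero_le_one, ENNReal.rpow_one]
      have e3 : (q + q * α) * (q / p) = q * α := by
        calc _ = q * ((α + 1) * (q / p)) := by ring
          _ = _ := by rw [hr]
      have e4 : c k * (V k)⁻¹ = z k ^ (α + 1) * (U k ^ (q + q * α) * (V k)⁻¹ ^ (α + 1)) := by
        rw [hc, ← e1, ← e2]
        simp only [rpow_neg_eq_inv_rpow]
        ring
      rw [e4, ENNReal.mul_rpow_of_nonneg _ _ hr0.le, ENNReal.mul_rpow_of_nonneg _ _ hr0.le,
        ← ENNReal.rpow_mul, ← ENNReal.rpow_mul, ← ENNReal.rpow_mul, hr, e3]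
      simp only [hc, rpow_neg_eq_inv_rpow]
      rw [ENNReal.rpow_add_of_nonneg _ _ hq.le (mul_pos hq hα).le]
      ring
    calc ∑ k ∈ Finset.range n, c k
        = ∑ k ∈ Finset.range n, z k * ((c k * (V k)⁻¹) ^ (q / p) * U k ^ q) :=
          Finset.sum_congr rfl fun k _ => (heq k).symm
      _ ≤ 4 * (D * (∑ k ∈ Finset.range n, c k * (V k)⁻¹ * V k) ^ (q / p)) :=
          hlow.trans (mul_le_mul_right h1 4)
      _ ≤ 4 * (D * (∑ k ∈ Finset.range n, c k) ^ (q / p)) := by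
          gcongr with k _
          rw [mul_assoc]
          exact mul_le_of_le_one_right' (ENNReal.inv_mul_le_one _)
      _ = _ := by ring
  refine le_trans (Finset.sum_le_sum fun k _ => ?_) key
  rw [hsup_eq_iSup_subtype, ENNReal.mul_iSup, ENNReal.mul_iSup]

lemma rpow_concave_step {r : ℝ} (hr0 : 0 < r) (hr1 : r < 1) {H a : ℝ≥0∞} (hH : H ≠ ⊤)
    (ha : a ≠ ⊤) :
    H ^ r + ENNReal.ofReal r * ((H + a) ^ (1 - r))⁻¹ * a ≤ (H + a) ^ r := by
  rcases eq_or_ne (H + a) 0 with h0 | h0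
  · obtain ⟨rfl, rfl⟩ := add_eq_zero.1 h0
    simp
  have ht : H + a ≠ ⊤ := ENNReal.add_ne_top.2 ⟨hH, ha⟩
  have hY0 : (H + a) ^ (1 - r) ≠ 0 := fun h =>
    h0 ((ENNReal.rpow_eq_zero_iff_of_pos (by linarith)).1 h)
  have hYt : (H + a) ^ (1 - r) ≠ ⊤ := ENNReal.rpow_ne_top_of_nonneg (by linarith) ht
  have hsplit : (H + a) ^ r * (H + a) ^ (1 - r) = H + a := by
    rw [← ENNReal.rpow_add _ _ h0 ht, add_sub_cancel, ENNReal.rpow_one]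
  have hone : ENNReal.ofReal r + ENNReal.ofReal (1 - r) = 1 := by
    rw [← ENNReal.ofReal_add hr0.le (by linarith), add_sub_cancel, ENNReal.ofReal_one]
  have hgm : H ^ r * (H + a) ^ (1 - r) ≤
      ENNReal.ofReal r * H + ENNReal.ofReal (1 - r) * (H + a) := by
    lift H to NNReal using hH
    lift a to NNReal using ha
    have := NNReal.geom_mean_le_arith_mean2_weighted r.toNNReal (1 - r).toNNReal H (H + a)
      (by rw [← Real.toNNReal_add hr0.le (by linarith)]; simp)
    rw [Real.coe_toNNReal _ hr0.le, Real.coe_toNNReal _ (by linarith)] at this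
    rw [← ENNReal.coe_add, ← ENNReal.coe_rpow_of_nonneg _ hr0.le,
      ← ENNReal.coe_rpow_of_nonneg _ (by linarith), ENNReal.ofReal, ENNReal.ofReal]
    exact_mod_cast this
  rw [← ENNReal.mul_le_mul_iff_left hY0 hYt, hsplit, add_mul]
  calc H ^ r * (H + a) ^ (1 - r) +
        ENNReal.ofReal r * ((H + a) ^ (1 - r))⁻¹ * a * (H + a) ^ (1 - r)
      = H ^ r * (H + a) ^ (1 - r) +
        ENNReal.ofReal r * a * (((H + a) ^ (1 - r))⁻¹ * (H + a) ^ (1 - r)) := by ring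
    _ ≤ ENNReal.ofReal r * H + ENNReal.ofReal (1 - r) * (H + a) + ENNReal.ofReal r * a := by
        rw [ENNReal.inv_mul_cancel hY0 hYt, mul_one]
        gcongr
    _ = (ENNReal.ofReal r + ENNReal.ofReal (1 - r)) * (H + a) := by ring
    _ = H + a := by rw [hone, one_mul]

lemma weighted_term_le {α r : ℝ} (hα : 0 < α) (hr1 : r < 1)
    (hr : (α + 1) * r = α) {k R K H : ℝ≥0∞} (hH : H ≠ ⊤)
    (haH : k * R ^ (α + 1) * K ^ α ≤ H) :
    k * R ^ α * K ^ α ≤ (H ^ (1 - r))⁻¹ * (k * R ^ (α + 1) * K ^ α) * K + H ^ r * k := by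
  rcases eq_or_ne H 0 with rfl | hH0
  · have h0 : k * R ^ α * K ^ α = 0 := by
      have := le_antisymm haH zero_le
      simp only [mul_eq_zero, ENNReal.rpow_eq_zero_iff_of_pos hα,
        ENNReal.rpow_eq_zero_iff_of_pos (show 0 < α + 1 by linarith)] at this ⊢
      exact this
    rw [h0]
    exact zero_le
  have hY0 : H ^ (1 - r) ≠ 0 := fun h =>
    hH0 ((ENNReal.rpow_eq_zero_iff_of_pos (by linarith)).1 h)
  have hYt : H ^ (1 - r) ≠ ⊤ := ENNReal.rpow_ne_top_of_nonneg (by linarith) hH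
  rcases le_total (H ^ (1 - r)) (R * K) with h | h
  · refine le_add_right ?_
    have h1 : 1 ≤ (H ^ (1 - r))⁻¹ * (R * K) := by
      rw [← ENNReal.inv_mul_cancel hY0 hYt]
      gcongr
    have e2 : R ^ (α + 1) = R ^ α * R := by
      rw [ENNReal.rpow_add_of_nonneg _ _ hα.le zero_le_one, ENNReal.rpow_one]
    calc k * R ^ α * K ^ α ≤ k * R ^ α * K ^ α * ((H ^ (1 - r))⁻¹ * (R * K)) :=
          le_mul_of_one_le_right' h1
      _ = _ := by rw [e2]; ring
  · refine le_add_left ?_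
    have h1 : (R * K) ^ α ≤ H ^ r := by
      have : (H ^ (1 - r)) ^ α = H ^ r := by
        rw [← ENNReal.rpow_mul]
        congr 1
        linarith
      rw [← this]
      gcongr
    rw [ENNReal.mul_rpow_of_nonneg _ _ hα.le] at h1
    calc k * R ^ α * K ^ α = R ^ α * K ^ α * k := by ring
      _ ≤ _ := by gcongr

lemma sum_increment_mul_le (P K m d : ℕ → ℝ≥0∞) (hK : ∀ l, K l ≤ m l + K (l + 1))
    (hd : ∀ l, P l + d l ≤ P (l + 1)) (n : ℕ) :
    ∑ l ∈ Finset.range n, d l * K (l + 1) ≤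
      ∑ l ∈ Finset.range n, P l * m l + P n * K n := by
  induction n with
  | zero => simp
  | succ n ih =>
    rw [Finset.sum_range_succ, Finset.sum_range_succ]
    calc _ ≤ ∑ l ∈ Finset.range n, P l * m l + P n * K n + d n * K (n + 1) := by gcongr
      _ ≤ ∑ l ∈ Finset.range n, P l * m l + P n * (m n + K (n + 1)) + d n * K (n + 1) := by
          gcongr
          exact hK n
      _ = ∑ l ∈ Finset.range n, P l * m l + P n * m n + (P n + d n) * K (n + 1) := by ring
      _ ≤ _ := by
          gcongr
          exact hd n

lemma sum_weighted_le {α r : ℝ} (hα : 0 < α) (hr0 : 0 < r) (hr1 : r < 1)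
    (hr : (α + 1) * r = α) (k R K m H : ℕ → ℝ≥0∞)
    (ha : ∀ l, k l * R l ^ (α + 1) * K (l + 1) ^ α ≠ ⊤)
    (hH : ∀ l, H l = ∑ i ∈ Finset.range l, k i * R i ^ (α + 1) * K (i + 1) ^ α)
    (hK : ∀ l, K l ≤ m l + K (l + 1)) {L : ℝ≥0∞} (n : ℕ)
    (h1 : ∑ l ∈ Finset.range n, H l ^ r * m l ≤ 4 * L)
    (h2 : ∑ l ∈ Finset.range n, H (l + 1) ^ r * k l ≤ 4 * L)
    (h3 : H n ^ r * K n ≤ L) :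
    ∑ l ∈ Finset.range n, k l * R l ^ α * K (l + 1) ^ α ≤
      9 * (ENNReal.ofReal r)⁻¹ * L := by
  set a : ℕ → ℝ≥0∞ := fun l => k l * R l ^ (α + 1) * K (l + 1) ^ α with ha_def
  have hHt : ∀ l, H l ≠ ⊤ := fun l => by
    rw [hH]
    exact ENNReal.sum_ne_top.2 fun i _ => ha i
  have hHs : ∀ l, H (l + 1) = H l + a l := fun l => by
    rw [hH, hH, Finset.sum_range_succ]
  have hρ0 : ENNReal.ofReal r ≠ 0 := by simpa using hr0
  have hρ1 : ENNReal.ofReal r ≤ 1 := by simpa using hr1.le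
  have h4 := sum_increment_mul_le (fun l => H l ^ r) K m
    (fun l => ENNReal.ofReal r * (H (l + 1) ^ (1 - r))⁻¹ * a l) hK
    (fun l => by
      rw [hHs]
      exact rpow_concave_step hr0 hr1 (hHt l) (ha l)) n
  have h5 : ENNReal.ofReal r * ∑ l ∈ Finset.range n, k l * R l ^ α * K (l + 1) ^ α ≤
      9 * L := by
    calc _ ≤ ENNReal.ofReal r * ∑ l ∈ Finset.range n,
          ((H (l + 1) ^ (1 - r))⁻¹ * a l * K (l + 1) + H (l + 1) ^ r * k l) := by
          gcongr with l _
          exact weighted_term_le hα hr1 hr (hHt _) (by rw [hHs]; exact le_add_self)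
      _ = ∑ l ∈ Finset.range n, ENNReal.ofReal r * (H (l + 1) ^ (1 - r))⁻¹ * a l * K (l + 1)
          + ENNReal.ofReal r * ∑ l ∈ Finset.range n, H (l + 1) ^ r * k l := by
          rw [Finset.sum_add_distrib, mul_add, Finset.mul_sum]
          congr 1
          refine Finset.sum_congr rfl fun l _ => ?_
          ring
      _ ≤ (4 * L + L) + 1 * (4 * L) := by
          gcongr
          exact h4.trans (add_le_add h1 h3)
      _ = 9 * L := by ring
  calc _ = (ENNReal.ofReal r)⁻¹ * (ENNReal.ofReal r *
        ∑ l ∈ Finset.range n, k l * R l ^ α * K (l + 1) ^ α) := by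
        rw [← mul_assoc, ENNReal.inv_mul_cancel hρ0 ENNReal.ofReal_ne_top, one_mul]
    _ ≤ (ENNReal.ofReal r)⁻¹ * (9 * L) := by gcongr
    _ = _ := by ring

/-- Summation by parts against a sequence that is halved at each step. -/
lemma sum_halving_le (z Q τ : ℕ → ℝ≥0∞) (hz : ∀ k, 2 * z (k + 1) = z k)
    (hQ : ∀ k, Q (k + 1) ≤ Q k) (n : ℕ) :
    ∑ k ∈ Finset.range n, z k * (Q k * ∑ l ∈ Finset.range (k + 1), τ l) ≤
      2 * ∑ l ∈ Finset.range n, z l * (Q l * τ l) := by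
  have key : ∑ k ∈ Finset.range n, z k * (Q k * ∑ l ∈ Finset.range (k + 1), τ l) +
      2 * z n * (Q n * ∑ l ∈ Finset.range n, τ l) ≤
      2 * ∑ l ∈ Finset.range n, z l * (Q l * τ l) := by
    induction n with
    | zero => simp
    | succ n ih =>
      rw [Finset.sum_range_succ, Finset.sum_range_succ (fun l => z l * (Q l * τ l)), hz, mul_add]
      refine le_trans ?_ (add_le_add_left ih _)
      calc _ ≤ ∑ k ∈ Finset.range n, z k * (Q k * ∑ l ∈ Finset.range (k + 1), τ l) +
            z n * (Q n * ∑ l ∈ Finset.range (n + 1), τ l) +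
            z n * (Q n * ∑ l ∈ Finset.range (n + 1), τ l) := by
            gcongr
            exact hQ n
        _ = _ := by
            rw [Finset.sum_range_succ τ]
            ring
  exact le_self_add.trans key

lemma ker_eq_ker_diag {b : EReal} {q : ℝ} (hq : 0 < q) (u w : ℝ → ℝ≥0∞) {m : ℝ} {s : EReal}
    (hs : s ≤ m) (hm : (m : EReal) ≤ b) : ker b q u w m s = ker b q u w m m := by
  rw [← ker_add q u w m m hs hm]
  have h0 : ∫⁻ y in io s m, w y * mass u m y ^ q = 0 := by
    rw [← lintegral_zero (μ := volume.restrict (io s m))]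
    refine setLIntegral_congr_fun (measurableSet_io _ _) fun y hy => ?_
    rw [mass_eq_zero_of_le u hy.2.le, ENNReal.zero_rpow_of_pos hq, mul_zero]
  rw [h0, zero_add]

lemma ker_diag_le_add {b : EReal} {q : ℝ} (hq : 0 < q) (hq1 : q ≤ 1) (u : ℝ → ℝ≥0∞)
    {w : ℝ → ℝ≥0∞} (hw : Measurable w) {t : EReal} {m : ℝ} (htm : t ≤ m)
    (hm : (m : EReal) ≤ b) :
    ker b q u w t t ≤ mass u t m ^ q * mass w t b + ker b q u w m m := by
  rw [← ker_eq_ker_diag hq u w htm hm]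
  exact ker_le_add hq hq1 u hw t m t

/-- The `l`-th cell of the subdivision of `[a, ∞]` by the points `x 1, x 2, …`. -/
def gridCell (a : EReal) (x : ℕ → ℝ) (l : ℕ) : Set EReal :=
  {t | a ≤ t ∧ (l ≠ 0 → (x l : EReal) ≤ t) ∧ t ≤ x (l + 1)}

lemma right_mem_gridCell {a : EReal} {x : ℕ → ℝ} (hx : StrictMono x) (hax : a ≤ x 0) (l : ℕ) :
    (x (l + 1) : EReal) ∈ gridCell a x l :=
  ⟨hax.trans (by exact_mod_cast hx.monotone (Nat.zero_le _)),
    fun _ => by exact_mod_cast hx.monotone (Nat.le_succ l), le_rfl⟩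

lemma hsup_le_sum_gridCell (a b : EReal) {q α : ℝ} (hq : 0 < q) (hq1 : q ≤ 1)
    (hα : 0 < α) (u v : ℝ → ℝ≥0∞) {x : ℕ → ℝ} (hx : StrictMono x) (k : ℕ) :
    hsup a b u v q α (x (k + 1)) ≤ ∑ l ∈ Finset.range (k + 1),
      ⨆ t : gridCell a x l, mass u t (x (l + 1)) ^ q * mass v t b ^ (-α) := by
  refine iSup₂_le ?_
  induction k with
  | zero =>
    intro t hat
    rw [zero_add, Finset.sum_range_one]
    rcases le_or_gt t (x 1) with ht | ht
    · exact le_iSup (fun t : gridCell a x 0 => mass u t (x (0 + 1)) ^ q * mass v t b ^ (-α))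
        ⟨t, hat, fun h => absurd rfl h, ht⟩
    · rw [mass_eq_zero_of_le u ht.le, ENNReal.zero_rpow_of_pos hq, zero_mul]
      exact zero_le
  | succ k ih =>
    intro t hat
    rw [Finset.sum_range_succ]
    have hcell : ∀ s ∈ gridCell a x (k + 1), mass u s (x (k + 1 + 1)) ^ q * mass v s b ^ (-α) ≤
        ⨆ t : gridCell a x (k + 1), mass u t (x (k + 1 + 1)) ^ q * mass v t b ^ (-α) :=
      fun s hs => le_iSup (fun t : gridCell a x (k + 1) =>
        mass u t (x (k + 1 + 1)) ^ q * mass v t b ^ (-α)) ⟨s, hs⟩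
    rcases le_or_gt t (x (k + 1)) with ht | ht
    · have hxk : (x (k + 1) : EReal) ∈ gridCell a x (k + 1) :=
        ⟨hat.trans ht, fun _ => le_rfl, by exact_mod_cast hx.monotone (Nat.le_succ _)⟩
      refine le_trans ?_ (add_le_add (ih t hat) (hcell _ hxk))
      calc _ ≤ (mass u t (x (k + 1)) + mass u (x (k + 1)) (x (k + 1 + 1))) ^ q *
            mass v t b ^ (-α) := by
            gcongr
            exact mass_le_add u _
        _ ≤ (mass u t (x (k + 1)) ^ q + mass u (x (k + 1)) (x (k + 1 + 1)) ^ q) *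
            mass v t b ^ (-α) := by
            gcongr
            exact ENNReal.rpow_add_le_add_rpow _ _ hq.le hq1
        _ ≤ _ := by
            rw [add_mul]
            exact add_le_add_right (mul_le_mul_right (antitone_mass_rpow_neg v hα ht) _) _
    · refine le_add_left ?_
      rcases le_or_gt t (x (k + 1 + 1)) with ht' | ht'
      · exact hcell t ⟨hat, fun _ => ht.le, ht'⟩
      · rw [mass_eq_zero_of_le u ht'.le, ENNReal.zero_rpow_of_pos hq, zero_mul]
        exact zero_le

lemma HardyBound.weighted_ne_top {a b : EReal} {p q α β : ℝ} (hp : 0 < p) (hq : 0 < q)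
    (hα : 0 < α) (hβ : 0 < β) {u v w : ℝ → ℝ≥0∞} (hu : IsWeight a b u) (hv : IsWeight a b v)
    (hw : IsWeight a b w) {D : ℝ≥0∞} (hDt : D ≠ ⊤) (hD : HardyBound a b p q u v w D)
    {t : EReal} (hat : a ≤ t) {y : ℝ} (hyb : (y : EReal) < b) {z : ℝ≥0∞} (hz : z ≠ ⊤) :
    z * mass u t y ^ q * (mass v t b)⁻¹ ^ β * ker b q u w y y ^ α ≠ ⊤ := by
  rcases le_or_gt (y : EReal) t with hyt | hty
  · rw [mass_eq_zero_of_le u hyt, ENNReal.zero_rpow_of_pos hq, mul_zero, zero_mul, zero_mul]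
    exact ENNReal.zero_ne_top
  rcases eq_or_ne (mass v t b) ⊤ with hV | hV
  · rw [hV, ENNReal.inv_top, ENNReal.zero_rpow_of_pos hβ, mul_zero, zero_mul]
    exact ENNReal.zero_ne_top
  have hfin := hD.finite hp hq hu hv hw hDt hat hV
  rw [← rpow_neg_eq_inv_rpow]
  exact ENNReal.mul_ne_top (ENNReal.mul_ne_top (ENNReal.mul_ne_top hz
    (ENNReal.rpow_ne_top_of_nonneg hq.le (hfin.2 y hty hyb).1))
    (mass_rpow_neg_ne_top hv hβ hat (hty.trans hyb)))
    (ENNReal.rpow_ne_top_of_nonneg hα.le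
      (ne_top_of_le_ne_top hfin.1 (ker_mono hq u w hty.le hty.le)))

lemma HardyBound.sum_gridCell_le {a b : EReal} {p q α : ℝ} (hq : 0 < q) (hqp : q < p)
    (hp1 : p ≤ 1) (hα : 0 < α) (hr : (α + 1) * (q / p) = α) {u v w : ℝ → ℝ≥0∞}
    (hu : IsWeight a b u) (hv : IsWeight a b v) (hw : IsWeight a b w) {D : ℝ≥0∞} (hDt : D ≠ ⊤)
    (hD : HardyBound a b p q u v w D) {x : ℕ → ℝ} (hx : IsGrid b w x) (hax : a ≤ x 0) (n : ℕ) :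
    ∑ k ∈ Finset.range n, mass w (x k) b * (ker b q u w (x (k + 1)) (x (k + 1)) ^ α *
      ⨆ t : gridCell a x k, mass u t (x (k + 1)) ^ q * mass v t b ^ (-α)) ≤
        (9 * (ENNReal.ofReal (q / p))⁻¹ * D) ^ (α + 1) := by
  have hp : 0 < p := hq.trans hqp
  have hr0 : 0 < q / p := by positivity
  have hr1 : q / p < 1 := (div_lt_one hp).2 hqp
  have haxl : ∀ l, a ≤ x l := fun l =>
    hax.trans (by exact_mod_cast hx.mono.monotone (Nat.zero_le _))
  set K : ℕ → ℝ≥0∞ := fun l => ker b q u w (x l) (x l) with hK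
  simp_rw [ENNReal.mul_iSup]
  refine sum_iSup_le (gridCell a x) (fun l => ⟨_, right_mem_gridCell hx.mono hax l⟩)
    (fun k t => mass w (x k) b * (K (k + 1) ^ α *
      (mass u t (x (k + 1)) ^ q * mass v t b ^ (-α)))) n fun t ht => ?_
  set R : ℕ → ℝ≥0∞ := fun l => (mass v (t l) b)⁻¹ with hR
  set k : ℕ → ℝ≥0∞ := fun l => mass w (x l) b * mass u (t l) (x (l + 1)) ^ q with hk
  set m : ℕ → ℝ≥0∞ := fun l => mass w (x l) b * mass u (x l) (x (l + 1)) ^ q with hm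
  set c : ℕ → ℝ≥0∞ := fun l => k l * R l ^ (α + 1) * K (l + 1) ^ α with hc
  have hT : ∑ l ∈ Finset.range n, k l * R l ^ α * K (l + 1) ^ α ≠ ⊤ :=
    ENNReal.sum_ne_top.2 fun l _ => hD.weighted_ne_top hp hq hα hα hu hv hw hDt (ht l).1
      (hx.lt_right _) (hx.finite l)
  have htx : ∀ {i l}, i < l → t i ≤ x l := fun {i l} hil =>
    (ht i).2.2.trans (by exact_mod_cast hx.mono.monotone hil)
  have htt : ∀ {i l}, i ≤ l → t i ≤ t l := fun {i l} hil => by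
    rcases hil.eq_or_lt with rfl | hil
    · exact le_rfl
    · exact (htx hil).trans ((ht l).2.1 (by omega))
  have hsum : ∑ l ∈ Finset.range n, mass w (x l) b * (K (l + 1) ^ α *
      (mass u (t l) (x (l + 1)) ^ q * mass v (t l) b ^ (-α))) =
        ∑ l ∈ Finset.range n, k l * R l ^ α * K (l + 1) ^ α := by
    refine Finset.sum_congr rfl fun l _ => ?_
    rw [rpow_neg_eq_inv_rpow]
    simp only [hk, hR]
    ring
  rw [hsum]
  refine le_rpow_of_le_mul_rpow (r := q / p) (by positivity) (by linarith) hT ?_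
  obtain ⟨Φ, -, h1, h2⟩ := hD.exists_test hp hq hu.1 hv.1 n t c
  have hcore := sum_weighted_le hα hr0 hr1 hr k R K m
    (fun l => ∑ i ∈ Finset.range l, c i)
    (fun l => hD.weighted_ne_top hp hq hα (by linarith) hu hv hw hDt (ht l).1
      (hx.lt_right _) (hx.finite l)) (fun _ => rfl)
    (fun l => by
      simp only [hm]
      rw [mul_comm]
      exact ker_diag_le_add hq (by linarith) u hw.1
        (by exact_mod_cast hx.mono.monotone (Nat.le_succ l)) (hx.lt_right _).le)
    (L := ∫⁻ y in io a b, Φ y * w y) n ?_ ?_ ?_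
  · refine hcore.trans ?_
    rw [mul_assoc _ D]
    refine mul_le_mul_right (h1.trans ?_) _
    refine mul_le_mul_right (ENNReal.rpow_le_rpow (Finset.sum_le_sum fun l _ => ?_) hr0.le) _
    have e1 : R l ^ (α + 1) * mass v (t l) b ≤ R l ^ α := by
      rw [ENNReal.rpow_add_of_nonneg _ _ hα.le zero_le_one, ENNReal.rpow_one, mul_assoc]
      exact mul_le_of_le_one_right' (ENNReal.inv_mul_le_one _)
    calc c l * mass v (t l) b = k l * (R l ^ (α + 1) * mass v (t l) b) * K (l + 1) ^ α := by
          simp only [hc]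
          ring
      _ ≤ _ := by gcongr
  · refine le_trans (Finset.sum_le_sum fun l _ => ?_) (hx.sum_le_lintegral (a := a) hw.1 hax
      (Φ := Φ) (e := fun l => (∑ i ∈ Finset.range l, c i) ^ (q / p) *
        mass u (x l) (x (l + 1)) ^ q) n fun l hl y hy => ?_)
    · simp only [hm]
      exact le_of_eq (by ring)
    · refine le_trans ?_ (h2 (Finset.range l) (Finset.range_subset_range.2 hl.le) (x l) (haxl l)
        (fun i hi => htx (Finset.mem_range.1 hi)) y (hy.2.trans (hx.lt_right _)))
      gcongr
      exact mass_mono u le_rfl hy.1.le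
  · refine le_trans (Finset.sum_le_sum fun l _ => ?_) (hx.sum_le_lintegral (a := a) hw.1 hax
      (Φ := Φ) (e := fun l => (∑ i ∈ Finset.range (l + 1), c i) ^ (q / p) *
        mass u (t l) (x (l + 1)) ^ q) n fun l hl y hy => ?_)
    · simp only [hk]
      exact le_of_eq (by ring)
    · refine le_trans ?_ (h2 (Finset.range (l + 1)) (Finset.range_subset_range.2 hl) (t l)
        (ht l).1 (fun i hi => htt (Nat.lt_succ_iff.1 (Finset.mem_range.1 hi))) y
        (hy.2.trans (hx.lt_right _)))
      gcongr
      exact mass_mono u le_rfl hy.1.le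
  · have hmeas : Measurable fun y : ℝ => w y * mass u (x n) y ^ q :=
      hw.1.mul ((measurable_mass_right u _).pow_const q)
    simp only [hK]
    rw [ker, mass, ← lintegral_const_mul _ hmeas]
    refine le_trans ?_ (lintegral_mono_set (io_subset_io (haxl n) le_rfl))
    refine setLIntegral_mono' (measurableSet_io _ _) fun y hy => ?_
    have h3 := h2 (Finset.range n) le_rfl (x n) (haxl n)
      (fun i hi => htx (Finset.mem_range.1 hi)) y hy.2
    calc _ = (∑ i ∈ Finset.range n, c i) ^ (q / p) * mass u (x n) y ^ q * w y := by
          ring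
      _ ≤ _ := by gcongr

lemma HardyBound.sum_ker_hsup_le {a b : EReal} {p q α : ℝ} (hq : 0 < q) (hqp : q < p)
    (hp1 : p ≤ 1) (hα : 0 < α) (hr : (α + 1) * (q / p) = α) {u v w : ℝ → ℝ≥0∞}
    (hu : IsWeight a b u) (hv : IsWeight a b v) (hw : IsWeight a b w) {D : ℝ≥0∞} (hDt : D ≠ ⊤)
    (hD : HardyBound a b p q u v w D) {x : ℕ → ℝ} (hx : IsGrid b w x) (hax : a ≤ x 0) (n : ℕ) :
    ∑ k ∈ Finset.range n, mass w (x k) b * (ker b q u w (x (k + 1)) (x (k + 1)) ^ α *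
      hsup a b u v q α (x (k + 1))) ≤ 2 * (9 * (ENNReal.ofReal (q / p))⁻¹ * D) ^ (α + 1) := by
  refine le_trans ?_ (mul_le_mul_right
    (hD.sum_gridCell_le hq hqp hp1 hα hr hu hv hw hDt hx hax n) 2)
  refine le_trans (Finset.sum_le_sum fun k _ => ?_) (sum_halving_le (fun k => mass w (x k) b)
    (fun k => ker b q u w (x (k + 1)) (x (k + 1)) ^ α)
    (fun k => ⨆ t : gridCell a x k, mass u t (x (k + 1)) ^ q * mass v t b ^ (-α))
    hx.half (fun k => ?_) n)
  · gcongr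
    exact hsup_le_sum_gridCell a b hq (by linarith) hα u v hx.mono k
  · have h : (x (k + 1) : EReal) ≤ x (k + 1 + 1) := by
      exact_mod_cast hx.mono.monotone (Nat.le_succ _)
    exact ENNReal.rpow_le_rpow (ker_mono hq u w h h) hα.le

lemma mass_rpow_mul_hsup_le {a b : EReal} {q α : ℝ} (hq : 0 < q) (hα : 0 < α)
    (u v : ℝ → ℝ≥0∞) {x y : ℝ} (hxy : x ≤ y) :
    mass u x y ^ (q * α) * hsup a b u v q α x ≤ hsup a b u v (q + q * α) α y := by
  simp only [hsup, ENNReal.mul_iSup]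
  refine iSup₂_le fun t hat => ?_
  rcases le_or_gt (x : EReal) t with hxt | htx
  · rw [mass_eq_zero_of_le u hxt, ENNReal.zero_rpow_of_pos hq, zero_mul, mul_zero]
    exact zero_le
  refine le_trans ?_ (le_hsup u v (q + q * α) α y hat)
  have hxy' : (x : EReal) ≤ y := by exact_mod_cast hxy
  calc mass u x y ^ (q * α) * (mass u t x ^ q * mass v t b ^ (-α))
      ≤ mass u t y ^ (q * α) * (mass u t y ^ q * mass v t b ^ (-α)) := by
        gcongr
        · exact mass_mono u htx.le le_rfl
        · exact mass_mono u le_rfl hxy'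
    _ = _ := by
        rw [ENNReal.rpow_add_of_nonneg _ _ hq.le (mul_pos hq hα).le]
        ring

lemma hardyH_le_block {a b : EReal} {q α : ℝ} (hq : 0 < q) (hq1 : q ≤ 1) (hα : 0 < α)
    (u v : ℝ → ℝ≥0∞) {w : ℝ → ℝ≥0∞} (hw : Measurable w) {x y x' : ℝ} (hxy : x ≤ y)
    (hyx : y ≤ x') (hb : (x' : EReal) < b) :
    hardyH a b q α u v w y ≤
      (1 + 2 ^ α) * (mass w x b ^ α * hsup a b u v (q + q * α) α x') +
        2 ^ α * (ker b q u w x' x' ^ α * hsup a b u v q α x') := by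
  have hxy' : (x : EReal) ≤ y := by exact_mod_cast hxy
  have hW : mass w y b ≤ mass w x b := mass_mono w hxy' le_rfl
  set S := hsup a b u v q α y
  set K := ker b q u w x' x'
  have h1 : ker b q u w y y ^ α * S ≤ 2 ^ α * (mass w x b ^ α *
      hsup a b u v (q + q * α) α x' + K ^ α * hsup a b u v q α x') := by
    calc ker b q u w y y ^ α * S ≤ (mass u y x' ^ q * mass w x b + K) ^ α * S := by
          gcongr
          refine (ker_diag_le_add hq hq1 u hw (by exact_mod_cast hyx) hb.le).trans ?_
          gcongr
      _ ≤ 2 ^ α * ((mass u y x' ^ q * mass w x b) ^ α + K ^ α) * S := by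
          gcongr
          exact ENNReal.add_rpow_le_two_rpow_mul_rpow_add_rpow _ _ hα.le
      _ = 2 ^ α * (mass w x b ^ α * (mass u y x' ^ (q * α) * S) + K ^ α * S) := by
          rw [ENNReal.mul_rpow_of_nonneg _ _ hα.le, ← ENNReal.rpow_mul]
          ring
      _ ≤ _ := by
          gcongr
          · exact mass_rpow_mul_hsup_le hq hα u v hyx
          · exact monotone_hsup a b u v α hq hyx
  calc hardyH a b q α u v w y ≤ mass w x b ^ α * hsup a b u v (q + q * α) α x' +
        2 ^ α * (mass w x b ^ α * hsup a b u v (q + q * α) α x' +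
          K ^ α * hsup a b u v q α x') := by
        unfold hardyH
        gcongr
        exact monotone_hsup a b u v α (by positivity) hyx
    _ = _ := by ring

/-- The constant obtained in the necessity part, before taking roots. -/
def necConst (α r : ℝ) : ℝ≥0∞ :=
  (1 + 2 ^ α) * 4 ^ (α + 1) + 2 ^ α * (2 * (9 * (ENNReal.ofReal r)⁻¹) ^ (α + 1))

lemma HardyBound.lintegral_hardyH_right_le {a b : EReal} {p q α : ℝ} (hq : 0 < q) (hqp : q < p)
    (hp1 : p ≤ 1) (hα : 0 < α) (hr : (α + 1) * (q / p) = α) {u v w : ℝ → ℝ≥0∞}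
    (hu : IsWeight a b u) (hv : IsWeight a b v) (hw : IsWeight a b w) {D : ℝ≥0∞} (hDt : D ≠ ⊤)
    (hD : HardyBound a b p q u v w D) {c : ℝ} (hac : a ≤ c) (hcb : (c : EReal) < b)
    (hfin : mass w c b ≠ ⊤) :
    ∫⁻ y in io c b, w y * hardyH a b q α u v w y ≤ necConst α (q / p) * D ^ (α + 1) := by
  obtain ⟨x, rfl, hx⟩ := exists_isGrid hw hac hcb hfin
  have hp : 0 < p := hq.trans hqp
  refine (hx.lintegral_le hw.1 fun k y hy => hardyH_le_block hq (by linarith) hα u v hw.1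
    hy.1 hy.2.le (hx.lt_right (k + 1))).trans ?_
  rw [ENNReal.tsum_eq_iSup_nat]
  refine iSup_le fun n => ?_
  have h2 := hD.sum_hsup_le hp hq hα hr hu hv hw hDt hx hac n
  have h3 := hD.sum_ker_hsup_le hq hqp hp1 hα hr hu hv hw hDt hx hac n
  have hα1 : 0 ≤ α + 1 := by linarith
  rw [ENNReal.mul_rpow_of_nonneg _ _ hα1] at h2 h3
  calc _ = (1 + 2 ^ α) * ∑ k ∈ Finset.range n, mass w (x k) b *
          (mass w (x k) b ^ α * hsup a b u v (q + q * α) α (x (k + 1))) +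
        2 ^ α * ∑ k ∈ Finset.range n, mass w (x k) b *
          (ker b q u w (x (k + 1)) (x (k + 1)) ^ α * hsup a b u v q α (x (k + 1))) := by
        rw [Finset.mul_sum, Finset.mul_sum, ← Finset.sum_add_distrib]
        refine Finset.sum_congr rfl fun k _ => ?_
        ring
    _ ≤ (1 + 2 ^ α) * (4 ^ (α + 1) * D ^ (α + 1)) +
        2 ^ α * (2 * ((9 * (ENNReal.ofReal (q / p))⁻¹) ^ (α + 1) * D ^ (α + 1))) := by
        gcongr
    _ = _ := by
        rw [necConst]
        ring

lemma hardyH_eq_zero {a b : EReal} {q α : ℝ} (hq : 0 < q) (hα : 0 < α) (u v w : ℝ → ℝ≥0∞)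
    {x : ℝ} (h : ∀ t : EReal, a ≤ t → t < x → mass v t b = ⊤) :
    hardyH a b q α u v w x = 0 := by
  have h0 : ∀ e : ℝ, 0 < e → hsup a b u v e α x = 0 := fun e he => by
    refine le_antisymm (iSup₂_le fun t hat => ?_) zero_le
    rcases lt_or_ge t (x : EReal) with htx | hxt
    · rw [h t hat htx, ENNReal.top_rpow_of_neg (by linarith), mul_zero]
    · rw [mass_eq_zero_of_le u hxt, ENNReal.zero_rpow_of_pos he, zero_mul]
  rw [hardyH, h0 _ (by positivity), h0 q hq, mul_zero, mul_zero, add_zero]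

lemma HardyBound.lintegral_hardyH_le {a b : EReal} {p q α : ℝ} (hq : 0 < q) (hqp : q < p)
    (hp1 : p ≤ 1) (hα : 0 < α) (hr : (α + 1) * (q / p) = α) {u v w : ℝ → ℝ≥0∞}
    (hab : a < b)
    (hu : IsWeight a b u) (hv : IsWeight a b v) (hw : IsWeight a b w) {D : ℝ≥0∞} (hDt : D ≠ ⊤)
    (hD : HardyBound a b p q u v w D) :
    ∫⁻ y in io a b, w y * hardyH a b q α u v w y ≤ necConst α (q / p) * D ^ (α + 1) := by
  set A : Set EReal := {t | a ≤ t ∧ mass v t b ≠ ⊤} with hA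
  have hbA : b ∈ A := ⟨hab.le, by
    rw [mass_eq_zero_of_le v le_rfl]
    exact ENNReal.zero_ne_top⟩
  have hae : a ≤ sInf A := le_sInf fun t ht => ht.1
  rw [← lintegral_inter_add_sdiff _ (io a b) (measurableSet_io (sInf A) b)]
  have hzero : ∫⁻ y in io a b \ io (sInf A) b, w y * hardyH a b q α u v w y = 0 := by
    rw [← lintegral_zero (μ := volume.restrict (io a b \ io (sInf A) b))]
    refine setLIntegral_congr_fun ((measurableSet_io _ _).diff (measurableSet_io _ _))
      fun y hy => ?_
    rw [hardyH_eq_zero hq hα u v w fun t hat hty => ?_, mul_zero]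
    by_contra hV
    exact hy.2 ⟨(sInf_le (show t ∈ A from ⟨hat, hV⟩)).trans_lt hty, hy.1.2⟩
  rw [hzero, add_zero]
  refine (lintegral_mono_set inter_subset_right).trans ?_
  refine mass_le_of_forall_left (fun y => w y * hardyH a b q α u v w y) fun c hc hcb => ?_
  obtain ⟨t, ht, htc⟩ := sInf_lt_iff.1 hc
  exact hD.lintegral_hardyH_right_le hq hqp hp1 hα hr hu hv hw hDt (hae.trans hc.le) hcb
    ((hD.finite (hq.trans hqp) hq hu hv hw hDt ht.1 ht.2).2 c htc hcb).2

/-- The constant in the necessity part. -/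
def necRoot (p q : ℝ) : ℝ≥0∞ :=
  2 * necConst (q / (p - q)) (q / p) ^ ((p - q) / (p * q))

lemma CC2_add_CC3_le {a b : EReal} {p q : ℝ} (hq : 0 < q) (hqp : q < p) (hp1 : p ≤ 1)
    (hab : a < b) {u v w : ℝ → ℝ≥0∞} (hu : IsWeight a b u) (hv : IsWeight a b v)
    (hw : IsWeight a b w) {C : ℝ≥0∞} (hC : C ≠ ⊤)
    (h : ∀ f : ℝ → ℝ≥0∞, Measurable f → MonotoneOn f (io a b) →
      lhsMon a b q u w f ≤ C * rhsNorm a b p v f) :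
    CC2 a b p q u v w + CC3 a b p q u v w ≤ necRoot p q * C := by
  have hp : 0 < p := hq.trans hqp
  have hpq : 0 < p - q := by linarith
  have hα : 0 < q / (p - q) := by positivity
  have hr : (q / (p - q) + 1) * (q / p) = q / (p - q) := by
    field_simp
    ring
  have he : 0 < p * q / (p - q) := by positivity
  have he' : 0 < (p - q) / (p * q) := by positivity
  have h1 := (HardyBound.of_lhsMon hq h).lintegral_hardyH_le hq hqp hp1 hα hr hab hu hv hw
    (ENNReal.rpow_ne_top_of_nonneg hq.le hC)
  have e1 : q * (q / (p - q) + 1) = p * q / (p - q) := by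
    field_simp
    ring
  have e2 : p * q / (p - q) * ((p - q) / (p * q)) = 1 := by field_simp
  rw [lintegral_hardyH_eq hq hqp hv hw, ← ENNReal.rpow_mul, e1] at h1
  have root : ∀ y : ℝ≥0∞, y ^ (p * q / (p - q)) ≤
      necConst (q / (p - q)) (q / p) * C ^ (p * q / (p - q)) →
      y ≤ necConst (q / (p - q)) (q / p) ^ ((p - q) / (p * q)) * C := fun y hy => by
    have := ENNReal.rpow_le_rpow hy he'.le
    rwa [ENNReal.mul_rpow_of_nonneg _ _ he'.le, ← ENNReal.rpow_mul, ← ENNReal.rpow_mul, e2,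
      ENNReal.rpow_one, ENNReal.rpow_one] at this
  calc _ ≤ _ := add_le_add (root _ (le_self_add.trans h1)) (root _ (le_add_self.trans h1))
    _ = _ := by
        rw [necRoot]
        ring

lemma necRoot_ne_top {p q : ℝ} (hq : 0 < q) (hqp : q < p) : necRoot p q ≠ ⊤ := by
  have hp : 0 < p := hq.trans hqp
  have hpq : 0 < p - q := by linarith
  have hα : 0 ≤ q / (p - q) + 1 := by positivity
  have hr : ENNReal.ofReal (q / p) ≠ 0 := by simpa using div_pos hq hp
  have hn : ∀ n : ℝ≥0∞, n ≠ ⊤ → n ^ (q / (p - q) + 1) ≠ ⊤ := fun n hn =>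
    ENNReal.rpow_ne_top_of_nonneg hα hn
  refine ENNReal.mul_ne_top (by norm_num) (ENNReal.rpow_ne_top_of_nonneg (by positivity) ?_)
  exact ENNReal.add_ne_top.2 ⟨ENNReal.mul_ne_top
    (ENNReal.add_ne_top.2 ⟨ENNReal.one_ne_top, two_rpow_ne_top _⟩) (hn _ (by norm_num)),
    ENNReal.mul_ne_top (two_rpow_ne_top _) (ENNReal.mul_ne_top (by norm_num)
      (hn _ (ENNReal.mul_ne_top (by norm_num) (ENNReal.inv_ne_top.2 hr))))⟩

lemma suffConst_ne_zero {p q : ℝ} (hq : 0 < q) (hqp : q < p) : suffConst p q ≠ 0 := by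
  have hp : 0 < p := hq.trans hqp
  have hpq : 0 < p - q := by linarith
  have h2 : ∀ e : ℝ, (2 : ℝ≥0∞) ^ e ≠ 0 := fun e =>
    (ENNReal.rpow_pos (by norm_num) (by norm_num)).ne'
  have hpos : ∀ {y : ℝ≥0∞} {e : ℝ}, 0 < e → y ≠ 0 → y ^ e ≠ 0 := fun he hy h =>
    hy ((ENNReal.rpow_eq_zero_iff_of_pos he).1 h)
  refine mul_ne_zero (mul_ne_zero (hpos (by positivity) (mul_ne_zero (h2 _) ?_))
    (hpos (by positivity) (mul_ne_zero (by norm_num) (mul_ne_zero (h2 _) (h2 _))))) (h2 _)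
  exact ENNReal.inv_ne_zero.2 (ne_top_of_le_ne_top ENNReal.one_ne_top tsub_le_self)

lemma lhsMon_le_mul_rhsNorm {a b : EReal} {p q : ℝ} (hq : 0 < q) (hqp : q < p) (hp1 : p ≤ 1)
    {u v w : ℝ → ℝ≥0∞} (hu : IsWeight a b u) (hv : IsWeight a b v) (hw : IsWeight a b w)
    (h2 : CC2 a b p q u v w ≠ ⊤) (h3 : CC3 a b p q u v w ≠ ⊤) {C : ℝ≥0∞}
    (hC : suffConst p q * (CC2 a b p q u v w + CC3 a b p q u v w) < C)
    {f : ℝ → ℝ≥0∞} (hfm : Measurable f) (hf : MonotoneOn f (io a b)) :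
    lhsMon a b q u w f ≤ C * rhsNorm a b p v f := by
  rcases eq_or_ne (rhsNorm a b p v f) ⊤ with hR | hR
  · rw [hR, ENNReal.mul_top (zero_le.trans_lt hC).ne']
    exact le_top
  · exact (lhsMon_le_of_finite hq hqp hp1 hu hv hw h2 h3 hfm hf hR).trans (by gcongr)

theorem monotone_hardy_case_ii (p q : ℝ) (hq : 0 < q)
    (hqp : q < p) (hp1 : p ≤ 1) :
    ∃ c₁ c₂ : ℝ≥0∞, 0 < c₁ ∧ c₂ < ⊤ ∧
      ∀ (a b : EReal), a < b → ∀ u v w : ℝ → ℝ≥0∞,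
        IsWeight a b u → IsWeight a b v → IsWeight a b w →
        ((∃ C : ℝ≥0∞, 0 < C ∧ C < ⊤ ∧ ∀ f : ℝ → ℝ≥0∞,
            Measurable f → MonotoneOn f (io a b) →
            lhsMon a b q u w f ≤ C * rhsNorm a b p v f) ↔
          (CC2 a b p q u v w < ⊤ ∧ CC3 a b p q u v w < ⊤)) ∧
        c₁ * (CC2 a b p q u v w + CC3 a b p q u v w) ≤ bestMon a b p q u v w ∧
        bestMon a b p q u v w ≤ c₂ * (CC2 a b p q u v w + CC3 a b p q u v w) := by
  refine ⟨(necRoot p q)⁻¹, suffConst p q, ENNReal.inv_pos.2 (necRoot_ne_top hq hqp),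
    (suffConst_ne_top hq hqp).lt_top, fun a b hab u v w hu hv hw => ⟨⟨?_, ?_⟩, ?_, ?_⟩⟩
  · rintro ⟨C, -, hC, h⟩
    have h1 := CC2_add_CC3_le hq hqp hp1 hab hu hv hw hC.ne h
    exact ENNReal.add_lt_top.1 (h1.trans_lt (ENNReal.mul_lt_top (necRoot_ne_top hq hqp).lt_top hC))
  · rintro ⟨h2, h3⟩
    have hfin : suffConst p q * (CC2 a b p q u v w + CC3 a b p q u v w) ≠ ⊤ :=
      ENNReal.mul_ne_top (suffConst_ne_top hq hqp) (ENNReal.add_ne_top.2 ⟨h2.ne, h3.ne⟩)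
    have hlt := ENNReal.lt_add_right hfin one_ne_zero
    exact ⟨_, zero_le.trans_lt hlt, ENNReal.add_lt_top.2 ⟨hfin.lt_top, ENNReal.one_lt_top⟩,
      fun f hfm hf => lhsMon_le_mul_rhsNorm hq hqp hp1 hu hv hw h2.ne h3.ne hlt hfm hf⟩
  · refine le_sInf fun C h => ?_
    rcases eq_or_ne C ⊤ with rfl | hC
    · exact le_top
    calc _ ≤ (necRoot p q)⁻¹ * (necRoot p q * C) := by
          gcongr
          exact CC2_add_CC3_le hq hqp hp1 hab hu hv hw hC h
      _ ≤ C := by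
          rw [← mul_assoc]
          exact mul_le_of_le_one_left' (ENNReal.inv_mul_le_one _)
  · rcases eq_or_ne (CC2 a b p q u v w + CC3 a b p q u v w) ⊤ with hX | hX
    · rw [hX, ENNReal.mul_top (suffConst_ne_zero hq hqp)]
      exact le_top
    obtain ⟨h2, h3⟩ := ENNReal.add_ne_top.1 hX
    refine le_of_forall_gt_imp_ge_of_dense fun C hC => sInf_le fun f hfm hf => ?_
    exact lhsMon_le_mul_rhsNorm hq hqp hp1 hu hv hw h2 h3 hC hfm hf
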